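/- arXiv:1804.09418 — 5 statements merged into one kernel-verified Lean document; each statement's English description precedes it below -/
import Mathlib

section
/- Fix a ∈ [0,1) and σ > 0. For every continuous function F on the interval [σ²/(1+a)², σ²/(1−a)²], the eigenvalues σ_i² of the covariance matrix σ²(AᵀA)⁻¹ satisfy lim_{n→∞} (1/n) Σ_{i=1}^n F(σ_i²) = (1/2π) ∫_{−π}^{π} F(S(w)) dw. -/
open MeasureTheory ProbabilityTheory Real Filter Matrix
open scoped NNReal ENNReal

noncomputable section

namespace GM

/-- Law of `n` i.i.d. centered Gaussian random variables with variance `σ²`. -/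
def gaussPi (σ : ℝ) (n : ℕ) : Measure (Fin n → ℝ) :=
  Measure.pi fun _ => gaussianReal 0 ⟨σ ^ 2, sq_nonneg σ⟩

/-- The Gauss-Markov evolution `U_{i+1} = ∑_{j ≤ i} a^(i-j) Z_{j+1}`
(equivalently `U_0 = 0`, `U_i = a U_{i-1} + Z_i`). -/
def evolve (a : ℝ) (n : ℕ) (z : Fin n → ℝ) : Fin n → ℝ :=
  fun i => ∑ j ∈ Finset.Iic i, a ^ ((i : ℕ) - (j : ℕ)) * z j

/-- Law of the Gauss-Markov source vector `(U_1, …, U_n)`. -/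
def sourceLaw (a σ : ℝ) (n : ℕ) : Measure (Fin n → ℝ) :=
  (gaussPi σ n).map (evolve a n)

/-- Mean squared error distortion. -/
def distortion (n : ℕ) (u v : Fin n → ℝ) : ℝ :=
  (1 / (n : ℝ)) * ∑ i, (u i - v i) ^ 2

/-- There exists an `(n, M, d, ε)` excess-distortion code for the Gauss-Markov source. -/
def IsCode (a σ : ℝ) (n M : ℕ) (d ε : ℝ) : Prop :=
  ∃ f : (Fin n → ℝ) → Fin M, ∃ g : Fin M → (Fin n → ℝ),
    Measurable f ∧
    sourceLaw a σ n {u | d < distortion n u (g (f u))} ≤ ENNReal.ofReal ε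

/-- Minimum achievable code size. -/
def Mstar (a σ : ℝ) (n : ℕ) (d ε : ℝ) : ℕ := sInf {M | IsCode a σ n M d ε}

/-- Minimum achievable source coding rate `R(n, d, ε)`. -/
def rate (a σ : ℝ) (n : ℕ) (d ε : ℝ) : ℝ := Real.log (Mstar a σ n d ε) / n

/-- Gaussian tail function `Q`. -/
def gaussQ (t : ℝ) : ℝ := ∫ s in Set.Ioi t, (Real.sqrt (2 * π))⁻¹ * Real.exp (-(s ^ 2) / 2)

/-- Power spectrum of the Gauss-Markov source. -/
def S (a σ w : ℝ) : ℝ := σ ^ 2 / (1 + a ^ 2 - 2 * a * Real.cos w)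

/-- The limiting reverse waterfilling equation relating distortion `d` and water level `θ`. -/
def waterEq (a σ θ d : ℝ) : Prop :=
  d = (1 / (2 * π)) * ∫ w in Set.Icc (-π) π, min θ (S a σ w)

/-- The rate-distortion function `R_U(d)`, parametrized by the water level `θ` matched to `d`. -/
def RU (a σ θ : ℝ) : ℝ :=
  (1 / (2 * π)) * ∫ w in Set.Icc (-π) π, max 0 ((1 / 2) * Real.log (S a σ w / θ))

/-- The dispersion `V_U(d)`, parametrized by the water level `θ` matched to `d`. -/
def VU (a σ θ : ℝ) : ℝ :=
  (1 / (4 * π)) * ∫ w in Set.Icc (-π) π, min 1 ((S a σ w / θ) ^ 2)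

/-- The lower bidiagonal matrix `A` with `1` on the diagonal, `-a` on the first subdiagonal. -/
def Amat (a : ℝ) (n : ℕ) : Matrix (Fin n) (Fin n) ℝ :=
  Matrix.of fun i j => if i = j then 1 else if (i : ℕ) = (j : ℕ) + 1 then -a else 0

/-- `μv` is the nondecreasing enumeration of the eigenvalues (with multiplicity) of the
real symmetric matrix `M`: it is monotone and `M = P D Pᵀ` for some orthogonal `P`. -/
def IsEigs {n : ℕ} (μv : Fin n → ℝ) (M : Matrix (Fin n) (Fin n) ℝ) : Prop :=
  Monotone μv ∧ ∃ P : Matrix (Fin n) (Fin n) ℝ,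
    P * Pᵀ = 1 ∧ Pᵀ * P = 1 ∧ M = P * Matrix.diagonal μv * Pᵀ

/-- The `i`-th entry of `u` (0-based), or `0` if out of range. -/
def entry {n : ℕ} (u : Fin n → ℝ) (i : ℕ) : ℝ := if h : i < n then u ⟨i, h⟩ else 0

/-- Maximum likelihood estimator `â(u) = (∑_{i=1}^{n-1} u_i u_{i+1}) / (∑_{i=1}^{n-1} u_i²)`. -/
def mle {n : ℕ} (u : Fin n → ℝ) : ℝ :=
  (∑ i ∈ Finset.range (n - 1), entry u i * entry u (i + 1)) /
    ∑ i ∈ Finset.range (n - 1), entry u i ^ 2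

/-- The `d`-tilted information expression, parametrized by a water level `θ`,
per-coordinate variances `sv`, evaluated at the point `x`. -/
def Jtilt {n : ℕ} (θ : ℝ) (sv : Fin n → ℝ) (x : Fin n → ℝ) : ℝ :=
  ∑ i, ((min θ (sv i) / (2 * θ)) * ((x i) ^ 2 / sv i - 1)
        + (1 / 2) * Real.log (max θ (sv i) / θ))

end GM

namespace GM

lemma A_zero (a : ℝ) (m : ℕ) (v : Fin (m+1) → ℝ) : (Amat a (m+1) *ᵥ v) 0 = v 0 := by
  simp only [Matrix.mulVec, dotProduct, Amat, Matrix.of_apply]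
  rw [Finset.sum_eq_single 0]
  · simp
  · intro j _ hj
    rw [if_neg (Ne.symm hj), if_neg (by simp), zero_mul]
  · simp

lemma A_succ (a : ℝ) (n : ℕ) (v : Fin n → ℝ) (i p : Fin n) (h : (i : ℕ) = p + 1) :
    (Amat a n *ᵥ v) i = v i - a * v p := by
  simp only [Matrix.mulVec, dotProduct, Amat, Matrix.of_apply]
  have : ∀ j : Fin n, (if i = j then (1:ℝ) else if (i : ℕ) = (j : ℕ) + 1 then -a else 0) * v j
      = (if i = j then v j else 0) + (if p = j then -a * v j else 0) := by
    intro j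
    have e1 : i = j ↔ (i:ℕ) = j := Fin.ext_iff
    have e2 : p = j ↔ (p:ℕ) = j := Fin.ext_iff
    simp only [e1, e2]
    split_ifs <;> first | omega | simp
  rw [Finset.sum_congr rfl (fun j _ => this j), Finset.sum_add_distrib]
  simp
  ring

lemma At_succ (a : ℝ) (n : ℕ) (v : Fin n → ℝ) (i p : Fin n) (h : (p : ℕ) = i + 1) :
    ((Amat a n)ᵀ *ᵥ v) i = v i - a * v p := by
  simp only [Matrix.mulVec, dotProduct, Amat, Matrix.of_apply, Matrix.transpose_apply]
  have : ∀ j : Fin n, (if j = i then (1:ℝ) else if (j : ℕ) = (i : ℕ) + 1 then -a else 0) * v j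
      = (if i = j then v j else 0) + (if p = j then -a * v j else 0) := by
    intro j
    have e1 : i = j ↔ (i:ℕ) = j := Fin.ext_iff
    have e0 : j = i ↔ (j:ℕ) = i := Fin.ext_iff
    have e2 : p = j ↔ (p:ℕ) = j := Fin.ext_iff
    simp only [e0, e1, e2]
    split_ifs <;> first | omega | simp
  rw [Finset.sum_congr rfl (fun j _ => this j), Finset.sum_add_distrib]
  simp
  ring

lemma norm_bounds (a : ℝ) (ha0 : 0 ≤ a) (ha1 : a < 1) (n : ℕ) (v : Fin n → ℝ)
    (hv : v ⬝ᵥ v = 1) :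
    (Amat a n *ᵥ v) ⬝ᵥ (Amat a n *ᵥ v) ∈ Set.Icc ((1-a)^2) ((1+a)^2) := by
  cases n with
  | zero => simp at hv
  | succ m =>
    have h1 : v 0 ^ 2 + ∑ i : Fin m, v i.succ ^ 2 = 1 := by
      rw [← hv, dotProduct, Fin.sum_univ_succ]; simp [sq]
    have h2 : ∑ i : Fin m, v i.castSucc ^ 2 + v (Fin.last m) ^ 2 = 1 := by
      rw [← hv, dotProduct, Fin.sum_univ_castSucc]; simp [sq]
    have h3 : (Amat a (m+1) *ᵥ v) ⬝ᵥ (Amat a (m+1) *ᵥ v)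
        = v 0 ^ 2 + ∑ i : Fin m, (v i.succ - a * v i.castSucc) ^ 2 := by
      rw [dotProduct, Fin.sum_univ_succ, A_zero]
      simp_rw [fun i : Fin m => A_succ a (m+1) v i.succ i.castSucc (by simp)]
      simp [sq]
    have lo : ∑ i : Fin m, ((1-a) * v i.succ ^ 2 - a * (1-a) * v i.castSucc ^ 2)
        ≤ ∑ i : Fin m, (v i.succ - a * v i.castSucc) ^ 2 := by
      refine Finset.sum_le_sum fun i _ => ?_
      nlinarith [mul_nonneg ha0 (sq_nonneg (v i.succ - v i.castSucc))]
    have hi : ∑ i : Fin m, (v i.succ - a * v i.castSucc) ^ 2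
        ≤ ∑ i : Fin m, ((1+a) * v i.succ ^ 2 + a * (1+a) * v i.castSucc ^ 2) := by
      refine Finset.sum_le_sum fun i _ => ?_
      nlinarith [mul_nonneg ha0 (sq_nonneg (v i.succ + v i.castSucc))]
    rw [Finset.sum_sub_distrib, ← Finset.mul_sum, ← Finset.mul_sum] at lo
    rw [Finset.sum_add_distrib, ← Finset.mul_sum, ← Finset.mul_sum] at hi
    rw [h3]
    have e1 : ∑ i : Fin m, v i.succ ^ 2 = 1 - v 0 ^ 2 := by linarith
    have e2 : ∑ i : Fin m, v i.castSucc ^ 2 = 1 - v (Fin.last m) ^ 2 := by linarith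
    rw [e1, e2] at lo hi
    have q0 := mul_nonneg ha0 (sq_nonneg (v 0))
    have q1 := mul_nonneg (mul_nonneg ha0 (sub_nonneg.2 ha1.le)) (sq_nonneg (v (Fin.last m)))
    have q2 := mul_nonneg (mul_nonneg ha0 (by linarith : 0 ≤ 1 + a)) (sq_nonneg (v (Fin.last m)))
    constructor <;> nlinarith

lemma eig_bounds (a : ℝ) (ha0 : 0 ≤ a) (ha1 : a < 1) (n : ℕ) (μ : Fin n → ℝ)
    (h : IsEigs μ ((Amat a n)ᵀ * Amat a n)) (i : Fin n) :
    μ i ∈ Set.Icc ((1-a)^2) ((1+a)^2) := by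
  obtain ⟨_, P, h1, h2, h3⟩ := h
  set v : Fin n → ℝ := fun j => P j i with hv
  have hvv : v ⬝ᵥ v = 1 := by
    have := congrFun (congrFun h2 i) i
    simpa [Matrix.mul_apply, dotProduct, hv] using this
  have key : (Amat a n *ᵥ v) ⬝ᵥ (Amat a n *ᵥ v) = μ i := by
    have e : Pᵀ * ((Amat a n)ᵀ * Amat a n) * P = Matrix.diagonal μ := by
      rw [h3]
      calc Pᵀ * (P * Matrix.diagonal μ * Pᵀ) * P
          = (Pᵀ * P) * Matrix.diagonal μ * (Pᵀ * P) := by simp only [Matrix.mul_assoc]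
        _ = _ := by rw [h2]; simp
    have e' : (Amat a n * P)ᵀ * (Amat a n * P) = Matrix.diagonal μ := by
      rw [← e, Matrix.transpose_mul]; simp only [Matrix.mul_assoc]
    have := congrFun (congrFun e' i) i
    rw [Matrix.diagonal_apply_eq] at this
    rw [← this]
    rfl
  rw [← key]
  exact norm_bounds a ha0 ha1 n v hvv

lemma pow_eq {n : ℕ} (μ : Fin n → ℝ) (M P : Matrix (Fin n) (Fin n) ℝ)
    (h1 : P * Pᵀ = 1) (h2 : Pᵀ * P = 1) (h3 : M = P * Matrix.diagonal μ * Pᵀ) (k : ℕ) :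
    M ^ k = P * Matrix.diagonal (fun i => μ i ^ k) * Pᵀ := by
  induction k with
  | zero => simp [h1]
  | succ k ih =>
    rw [pow_succ, ih, h3]
    calc P * Matrix.diagonal (fun i => μ i ^ k) * Pᵀ * (P * Matrix.diagonal μ * Pᵀ)
        = P * (Matrix.diagonal (fun i => μ i ^ k) * (Pᵀ * P) * Matrix.diagonal μ) * Pᵀ := by
          simp only [Matrix.mul_assoc]
      _ = _ := by rw [h2]; simp [pow_succ]

lemma diag_bound {n : ℕ} (μ : Fin n → ℝ) (M P : Matrix (Fin n) (Fin n) ℝ)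
    (h1 : P * Pᵀ = 1) (h2 : Pᵀ * P = 1) (h3 : M = P * Matrix.diagonal μ * Pᵀ) (k : ℕ)
    (hμ : ∀ i, |μ i| ≤ 4) (i : Fin n) : |(M ^ k) i i| ≤ 4 ^ k := by
  rw [pow_eq μ M P h1 h2 h3]
  have hP : ∑ l, P i l * P i l = 1 := by
    have := congrFun (congrFun h1 i) i
    simpa [Matrix.mul_apply] using this
  rw [Matrix.mul_apply]
  simp only [Matrix.mul_diagonal, Matrix.transpose_apply]
  calc |∑ l, P i l * μ l ^ k * P i l| ≤ ∑ l, |P i l * μ l ^ k * P i l| :=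
        Finset.abs_sum_le_sum_abs _ _
    _ ≤ ∑ l, 4 ^ k * (P i l * P i l) := by
        refine Finset.sum_le_sum fun l _ => ?_
        rw [show P i l * μ l ^ k * P i l = μ l ^ k * (P i l * P i l) by ring, abs_mul,
          abs_of_nonneg (mul_self_nonneg (P i l)), abs_pow]
        exact mul_le_mul_of_nonneg_right (pow_le_pow_left₀ (abs_nonneg _) (hμ l) k)
          (mul_self_nonneg _)
    _ = 4 ^ k := by rw [← Finset.mul_sum, hP, mul_one]

lemma trace_pow {n : ℕ} (μ : Fin n → ℝ) (M P : Matrix (Fin n) (Fin n) ℝ)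
    (h1 : P * Pᵀ = 1) (h2 : Pᵀ * P = 1) (h3 : M = P * Matrix.diagonal μ * Pᵀ) (k : ℕ) :
    ∑ i, μ i ^ k = ∑ i, (M ^ k) i i := by
  change _ = Matrix.trace (M ^ k)
  rw [pow_eq μ M P h1 h2 h3, Matrix.trace_mul_comm, ← Matrix.mul_assoc, h2, one_mul,
    Matrix.trace_diagonal]

/-- symbol -/
def g (a w : ℝ) : ℝ := 1 + a ^ 2 - 2 * a * Real.cos w

lemma g_cont (a : ℝ) : Continuous (g a) := by unfold g; fun_prop

/-- Fourier coefficients of powers of the symbol -/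
def c (a : ℝ) (k : ℕ) (m : ℤ) : ℝ := (1 / (2 * π)) * ∫ w in (-π)..π, g a w ^ k * Real.cos (m * w)

lemma c_zero (a : ℝ) (m : ℤ) : c a 0 m = if m = 0 then 1 else 0 := by
  unfold c
  split_ifs with h
  · subst h
    simp
    field_simp
    norm_num
  · have hm : (m : ℝ) ≠ 0 := by exact_mod_cast h
    simp only [pow_zero, one_mul]
    rw [intervalIntegral.integral_comp_mul_left (fun x => Real.cos x) hm, integral_cos]
    simp [Real.sin_int_mul_pi]

lemma c_succ (a : ℝ) (k : ℕ) (m : ℤ) :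
    c a (k+1) m = (1 + a^2) * c a k m - a * c a k (m+1) - a * c a k (m-1) := by
  have hi : ∀ m : ℤ, IntervalIntegrable (fun w => g a w ^ k * Real.cos (m * w)) volume (-π) π := by
    intro m
    apply Continuous.intervalIntegrable
    have := g_cont a
    fun_prop
  have : ∫ w in (-π)..π, g a w ^ (k+1) * Real.cos (m * w)
      = ∫ w in (-π)..π, ((1 + a^2) * (g a w ^ k * Real.cos (m * w))
        - a * (g a w ^ k * Real.cos ((m+1 : ℤ) * w))
        - a * (g a w ^ k * Real.cos ((m-1 : ℤ) * w))) := by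
    congr 1
    ext w
    push_cast
    rw [add_mul (m:ℝ) 1 w, sub_mul (m:ℝ) 1 w, one_mul, Real.cos_add, Real.cos_sub, pow_succ]
    conv_lhs => rw [show g a w ^ k * g a w = g a w ^ k * (1 + a ^ 2 - 2 * a * Real.cos w) from rfl]
    ring
  unfold c
  rw [this, intervalIntegral.integral_sub, intervalIntegral.integral_sub,
    intervalIntegral.integral_const_mul, intervalIntegral.integral_const_mul,
    intervalIntegral.integral_const_mul]
  · ring
  · exact (hi m).const_mul _
  · exact (hi _).const_mul _
  · exact ((hi m).const_mul _).sub ((hi _).const_mul _)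
  · exact (hi _).const_mul _

lemma entry_eq (a : ℝ) (n k : ℕ) (i j : Fin n) (h1 : k ≤ (i:ℕ)) (h2 : (i:ℕ) + k < n) :
    (((Amat a n)ᵀ * Amat a n) ^ k) i j = c a k ((i:ℤ) - (j:ℤ)) := by
  induction k generalizing i with
  | zero =>
    rw [c_zero, pow_zero, Matrix.one_apply]
    have : i = j ↔ ((i:ℤ) - (j:ℤ) = 0) := by rw [Fin.ext_iff]; omega
    simp only [this]
  | succ k ih =>
    rw [pow_succ', Matrix.mul_assoc]
    set X := ((Amat a n)ᵀ * Amat a n) ^ k with hX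
    let p : Fin n := ⟨i - 1, by omega⟩
    let q : Fin n := ⟨i + 1, by omega⟩
    have hp : (i:ℕ) = p + 1 := by simp [p]; omega
    have hq : (q:ℕ) = i + 1 := rfl
    have e : ((Amat a n)ᵀ * (Amat a n * X)) i j
        = ((Amat a n)ᵀ *ᵥ (Amat a n *ᵥ (fun l => X l j))) i := rfl
    rw [e, At_succ a n _ i q hq, A_succ a n _ i p hp, A_succ a n _ q i hq,
      ih i (by omega) (by omega), ih p (by omega) (by omega), ih q (by omega) (by omega), c_succ]
    have e1 : (p:ℤ) - j = (i:ℤ) - j - 1 := by omega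
    have e2 : (q:ℤ) - j = (i:ℤ) - j + 1 := by omega
    rw [e1, e2]
    ring

lemma card_bd (n k : ℕ) :
    (Finset.univ.filter (fun i : Fin n => ¬ (k ≤ (i:ℕ) ∧ (i:ℕ) + k < n))).card ≤ 2 * k := by
  have : ((Finset.univ.filter (fun i : Fin n => ¬ (k ≤ (i:ℕ) ∧ (i:ℕ) + k < n))).map
      Fin.valEmbedding) ⊆ Finset.range k ∪ Finset.Ico (n - k) n := by
    intro x hx
    simp only [Finset.mem_map, Finset.mem_filter, Finset.mem_univ, true_and,
      Fin.valEmbedding_apply] at hx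
    obtain ⟨y, hy, rfl⟩ := hx
    have := y.2
    simp only [Finset.mem_union, Finset.mem_range, Finset.mem_Ico]
    omega
  have h := (Finset.card_le_card this).trans (Finset.card_union_le _ _)
  rw [Finset.card_map] at h
  simp only [Finset.card_range, Nat.card_Ico] at h
  omega

lemma moment (a : ℝ) (ha0 : 0 ≤ a) (ha1 : a < 1) (μv : (n : ℕ) → Fin n → ℝ)
    (hμ : ∀ n, IsEigs (μv n) ((Amat a n)ᵀ * Amat a n)) (k : ℕ) :
    Tendsto (fun n : ℕ => (1 / (n : ℝ)) * ∑ i : Fin n, μv n i ^ k) atTop (nhds (c a k 0)) := by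
  set C : ℝ := 2 * k * (4 ^ k + |c a k 0|) with hC
  have key : ∀ n : ℕ, |∑ i : Fin n, μv n i ^ k - n * c a k 0| ≤ C := by
    intro n
    have hb := eig_bounds a ha0 ha1 n (μv n) (hμ n)
    obtain ⟨_, P, h1, h2, h3⟩ := hμ n
    have hb4 : ∀ i, |μv n i| ≤ 4 := by
      intro i
      have := hb i
      rw [abs_le]
      constructor
      · nlinarith [this.1, sq_nonneg (1 - a)]
      · nlinarith [this.2]
    rw [trace_pow (μv n) _ P h1 h2 h3 k]
    have e : ∑ i : Fin n, (((Amat a n)ᵀ * Amat a n) ^ k) i i - n * c a k 0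
        = ∑ i : Fin n, ((((Amat a n)ᵀ * Amat a n) ^ k) i i - c a k 0) := by
      rw [Finset.sum_sub_distrib]; simp
    rw [e]
    refine (Finset.abs_sum_le_sum_abs _ _).trans ?_
    have : ∀ i : Fin n, |(((Amat a n)ᵀ * Amat a n) ^ k) i i - c a k 0|
        ≤ if ¬ (k ≤ (i:ℕ) ∧ (i:ℕ) + k < n) then (4 ^ k + |c a k 0|) else 0 := by
      intro i
      split_ifs with h
      · rw [entry_eq a n k i i h.1 h.2]
        simp
      · exact (abs_sub _ _).trans (add_le_add (diag_bound (μv n) _ P h1 h2 h3 k hb4 i) le_rfl)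
    refine (Finset.sum_le_sum fun i _ => this i).trans ?_
    rw [← Finset.sum_filter, Finset.sum_const, nsmul_eq_mul, hC]
    refine mul_le_mul_of_nonneg_right ?_ (by positivity)
    exact_mod_cast card_bd n k
  rw [tendsto_iff_norm_sub_tendsto_zero]
  refine squeeze_zero' (Eventually.of_forall fun _ => norm_nonneg _) ?_
    (tendsto_const_div_atTop_nhds_zero_nat C)
  filter_upwards [eventually_gt_atTop 0] with n hn
  have hn' : (0:ℝ) < n := by exact_mod_cast hn
  have : 1 / (n:ℝ) * ∑ i : Fin n, μv n i ^ k - c a k 0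
      = (∑ i : Fin n, μv n i ^ k - n * c a k 0) / n := by field_simp
  rw [this, Real.norm_eq_abs, abs_div, abs_of_pos hn']
  exact div_le_div_of_nonneg_right (key n) hn'.le

lemma poly_lim (a : ℝ) (ha0 : 0 ≤ a) (ha1 : a < 1) (μv : (n : ℕ) → Fin n → ℝ)
    (hμ : ∀ n, IsEigs (μv n) ((Amat a n)ᵀ * Amat a n)) (p : Polynomial ℝ) :
    Tendsto (fun n : ℕ => (1 / (n : ℝ)) * ∑ i : Fin n, p.eval (μv n i)) atTop
      (nhds ((1 / (2 * π)) * ∫ w in (-π)..π, p.eval (g a w))) := by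
  have hg := g_cont a
  induction p using Polynomial.induction_on' with
  | add p q hp hq =>
    have := hp.add hq
    simp only [Polynomial.eval_add, Finset.sum_add_distrib]
    rw [intervalIntegral.integral_add, mul_add]
    · simpa only [mul_add] using this
    · exact Continuous.intervalIntegrable (p.continuous.comp hg) _ _
    · exact Continuous.intervalIntegrable (q.continuous.comp hg) _ _
  | monomial k r =>
    have := (moment a ha0 ha1 μv hμ k).const_mul r
    simp only [Polynomial.eval_monomial, ← Finset.mul_sum]
    rw [intervalIntegral.integral_const_mul]
    have e : r * c a k 0 = 1 / (2 * π) * (r * ∫ w in (-π)..π, g a w ^ k) := by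
      unfold c; simp; ring
    rw [e] at this
    refine this.congr fun n => by ring

lemma g_mem (a : ℝ) (ha0 : 0 ≤ a) (w : ℝ) : g a w ∈ Set.Icc ((1-a)^2) ((1+a)^2) := by
  unfold g
  constructor
  · nlinarith [mul_nonneg ha0 (sub_nonneg.2 (Real.cos_le_one w))]
  · nlinarith [mul_nonneg ha0 (by linarith [Real.neg_one_le_cos w] : 0 ≤ 1 + Real.cos w)]

lemma cont_lim (a : ℝ) (ha0 : 0 ≤ a) (ha1 : a < 1) (μv : (n : ℕ) → Fin n → ℝ)
    (hμ : ∀ n, IsEigs (μv n) ((Amat a n)ᵀ * Amat a n)) (G : ℝ → ℝ)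
    (hG : ContinuousOn G (Set.Icc ((1-a)^2) ((1+a)^2))) :
    Tendsto (fun n : ℕ => (1 / (n : ℝ)) * ∑ i : Fin n, G (μv n i)) atTop
      (nhds ((1 / (2 * π)) * ∫ w in (-π)..π, G (g a w))) := by
  have hg := g_cont a
  rw [Metric.tendsto_atTop]
  intro ε hε
  obtain ⟨p, hp⟩ := exists_polynomial_near_of_continuousOn _ _ G hG (ε/3) (by positivity)
  obtain ⟨N, hN⟩ := Metric.tendsto_atTop.1 (poly_lim a ha0 ha1 μv hμ p) (ε/3) (by positivity)
  refine ⟨N, fun n hn => ?_⟩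
  have h1 := hN n hn
  rw [Real.dist_eq] at h1 ⊢
  have h2 : |(1 / (n : ℝ)) * ∑ i : Fin n, p.eval (μv n i)
      - (1 / (n : ℝ)) * ∑ i : Fin n, G (μv n i)| ≤ ε/3 := by
    rw [← mul_sub, ← Finset.sum_sub_distrib, abs_mul]
    have : |∑ i : Fin n, (p.eval (μv n i) - G (μv n i))| ≤ n * (ε/3) := by
      refine (Finset.abs_sum_le_sum_abs _ _).trans ?_
      refine (Finset.sum_le_sum fun i _ =>
        (hp _ (eig_bounds a ha0 ha1 n (μv n) (hμ n) i)).le).trans ?_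
      simp
    rcases Nat.eq_zero_or_pos n with h0 | h0
    · subst h0; simp; positivity
    · have hn' : (0:ℝ) < n := by exact_mod_cast h0
      rw [abs_of_pos (by positivity : 0 < 1 / (n:ℝ))]
      calc 1 / (n:ℝ) * _ ≤ 1 / (n:ℝ) * (n * (ε/3)) :=
            mul_le_mul_of_nonneg_left this (by positivity)
        _ = ε/3 := by field_simp
  have h3 : |(1 / (2 * π)) * (∫ w in (-π)..π, p.eval (g a w))
      - (1 / (2 * π)) * ∫ w in (-π)..π, G (g a w)| ≤ ε/3 := by
    have hGg : Continuous (fun w => G (g a w)) := by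
      have := hG.comp_continuous hg (g_mem a ha0)
      exact this
    have hpg : Continuous (fun w => p.eval (g a w)) := p.continuous.comp hg
    rw [← mul_sub, ← intervalIntegral.integral_sub (hpg.intervalIntegrable _ _)
      (hGg.intervalIntegrable _ _), abs_mul, abs_of_pos (by positivity : 0 < 1 / (2 * π))]
    have := intervalIntegral.norm_integral_le_of_norm_le_const (a := -π) (b := π) (C := ε/3)
      (f := fun w => p.eval (g a w) - G (g a w)) (fun w _ => (hp _ (g_mem a ha0 w)).le)
    rw [Real.norm_eq_abs, show π - -π = 2 * π by ring,
      abs_of_pos (by positivity : 0 < 2 * π)] at this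
    calc 1 / (2*π) * _ ≤ 1 / (2*π) * (ε/3 * (2*π)) :=
          mul_le_mul_of_nonneg_left this (by positivity)
      _ = ε/3 := by field_simp
  rw [abs_lt] at h1 ⊢
  rw [abs_le] at h2 h3
  constructor <;> linarith [h1.1, h1.2, h2.1, h2.2, h3.1, h3.2]

end GM

theorem stmt4 (a σ : ℝ) (ha0 : 0 ≤ a) (ha1 : a < 1) (hσ : 0 < σ)
    (μv : (n : ℕ) → Fin n → ℝ)
    (hμ : ∀ n, GM.IsEigs (μv n) ((GM.Amat a n)ᵀ * GM.Amat a n))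
    (F : ℝ → ℝ)
    (hF : ContinuousOn F (Set.Icc (σ ^ 2 / (1 + a) ^ 2) (σ ^ 2 / (1 - a) ^ 2))) :
    Filter.Tendsto (fun n : ℕ => (1 / (n : ℝ)) * ∑ i : Fin n, F (σ ^ 2 / μv n i))
      Filter.atTop
      (nhds ((1 / (2 * π)) * ∫ w in Set.Icc (-π) π, F (GM.S a σ w))) := by
  have hG : ContinuousOn (fun x => F (σ ^ 2 / x)) (Set.Icc ((1-a)^2) ((1+a)^2)) := by
    have h1 : 0 < (1 - a)^2 := by have : 0 < 1 - a := by linarith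
                                  positivity
    have h2 : 0 < (1 + a)^2 := by positivity
    refine hF.comp (f := fun x => σ ^ 2 / x) ?_ ?_
    · exact continuousOn_const.div continuousOn_id (fun x hx => (h1.trans_le hx.1).ne')
    · intro x hx
      have hx0 : 0 < x := h1.trans_le hx.1
      exact ⟨div_le_div_of_nonneg_left (by positivity) hx0 hx.2,
        div_le_div_of_nonneg_left (by positivity) h1 hx.1⟩
  have := GM.cont_lim a ha0 ha1 μv hμ _ hG
  rw [intervalIntegral.integral_of_le (by linarith [Real.pi_pos]),
    ← MeasureTheory.integral_Icc_eq_integral_Ioc] at this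
  exact this

end
end

section
/- Fix a ∈ [0,1). For every n ∈ ℕ, let 0 < μ_1 ≤ μ_2 ≤ … ≤ μ_n be the eigenvalues of AᵀA, where A is the n×n lower-bidiagonal matrix with 1 on the diagonal and −a on the first subdiagonal, and let ξ_i = 1 + a² − 2a·cos(iπ/(n+1)) for i = 1, …, n. Then 0 ≤ ξ_i − μ_i ≤ 2aπ/n for all i ∈ {1, …, n}. -/
open MeasureTheory ProbabilityTheory Real Filter Matrix
open scoped NNReal ENNReal

noncomputable section

namespace GMaux

lemma quad {n : ℕ} (μv : Fin n → ℝ) (P : Matrix (Fin n) (Fin n) ℝ) (x : Fin n → ℝ) :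
    x ⬝ᵥ ((P * Matrix.diagonal μv * Pᵀ) *ᵥ x) = ∑ k, μv k * ((Pᵀ *ᵥ x) k) ^ 2 := by
  rw [← Matrix.mulVec_mulVec, ← Matrix.mulVec_mulVec, Matrix.dotProduct_mulVec,
    ← Matrix.mulVec_transpose]
  simp only [dotProduct, Matrix.mulVec_diagonal]
  exact Finset.sum_congr rfl fun k _ => by ring

lemma normsq {n : ℕ} (P : Matrix (Fin n) (Fin n) ℝ) (h : P * Pᵀ = 1) (x : Fin n → ℝ) :
    x ⬝ᵥ x = ∑ k, ((Pᵀ *ᵥ x) k) ^ 2 := by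
  have := quad (fun _ => 1) P x
  have h1 : Matrix.diagonal (fun _ : Fin n => (1:ℝ)) = 1 := Matrix.diagonal_one
  rw [h1, mul_one, h, Matrix.one_mulVec] at this
  simpa using this

lemma dot_pos {n : ℕ} {x : Fin n → ℝ} (h : x ≠ 0) : 0 < x ⬝ᵥ x := by
  obtain ⟨i, hi⟩ := Function.ne_iff.1 h
  have hi : x i ≠ 0 := hi
  apply Finset.sum_pos' (fun i _ => mul_self_nonneg _) ⟨i, Finset.mem_univ _, ?_⟩
  exact mul_self_pos.2 hi

lemma exists_kernel {n : ℕ} (R : Fin n → Fin n → ℝ) (i : Fin n) (hR : R i = 0) :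
    ∃ x : Fin n → ℝ, x ≠ 0 ∧ ∀ j, R j ⬝ᵥ x = 0 := by
  have hd : (Matrix.of R).det = 0 := Matrix.det_eq_zero_of_row_eq_zero i (fun j => by simp [hR])
  obtain ⟨x, hx, h⟩ := Matrix.exists_mulVec_eq_zero_iff.2 hd
  exact ⟨x, hx, fun j => congrFun h j⟩

/-- lower: if coordinates below `m` vanish -/
lemma low {n : ℕ} {μv : Fin n → ℝ} (c : ℝ) (y : Fin n → ℝ)
    (h : ∀ k, y k = 0 ∨ c ≤ μv k) : c * ∑ k, y k ^ 2 ≤ ∑ k, μv k * y k ^ 2 := by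
  rw [Finset.mul_sum]
  refine Finset.sum_le_sum fun k _ => ?_
  rcases h k with h | h
  · simp [h]
  · exact mul_le_mul_of_nonneg_right h (sq_nonneg _)

lemma upp {n : ℕ} {μv : Fin n → ℝ} (c : ℝ) (y : Fin n → ℝ)
    (h : ∀ k, y k = 0 ∨ μv k ≤ c) : ∑ k, μv k * y k ^ 2 ≤ c * ∑ k, y k ^ 2 := by
  rw [Finset.mul_sum]
  refine Finset.sum_le_sum fun k _ => ?_
  rcases h k with h | h
  · simp [h]
  · exact mul_le_mul_of_nonneg_right h (sq_nonneg _)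

lemma weyl {n : ℕ} {μv ξ : Fin n → ℝ} {M T : Matrix (Fin n) (Fin n) ℝ}
    (hM : GM.IsEigs μv M) (hT : GM.IsEigs ξ T)
    (h : ∀ x, x ⬝ᵥ (M *ᵥ x) ≤ x ⬝ᵥ (T *ᵥ x)) (i : Fin n) : μv i ≤ ξ i := by
  obtain ⟨m1, P, hP, -, rfl⟩ := hM
  obtain ⟨m2, Q, hQ, -, rfl⟩ := hT
  obtain ⟨x, hx, hk⟩ := exists_kernel
    (fun j => if j < i then Pᵀ j else if i < j then Qᵀ j else 0) i (by simp)
  have hp := dot_pos hx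
  have h1 := h x
  rw [quad, quad] at h1
  have h2 := low (μv := μv) (μv i) (Pᵀ *ᵥ x) (fun k => by
    rcases lt_or_ge k i with hki | hki
    · left; have := hk k; simp only [hki, if_true] at this; exact this
    · right; exact m1 hki)
  have h3 := upp (μv := ξ) (ξ i) (Qᵀ *ᵥ x) (fun k => by
    rcases lt_or_ge i k with hki | hki
    · left; have := hk k; simp only [hki, if_true, not_lt_of_gt hki, if_false] at this; exact this
    · right; exact m2 hki)
  rw [← normsq P hP] at h2
  rw [← normsq Q hQ] at h3
  exact le_of_mul_le_mul_right (h2.trans (h1.trans h3)) hp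

lemma interlace {n : ℕ} {μv ξ : Fin n → ℝ} {M T : Matrix (Fin n) (Fin n) ℝ}
    (hM : GM.IsEigs μv M) (hT : GM.IsEigs ξ T) (e : Fin n → ℝ)
    (h : ∀ x, e ⬝ᵥ x = 0 → x ⬝ᵥ (T *ᵥ x) ≤ x ⬝ᵥ (M *ᵥ x)) (i i' : Fin n)
    (hi : (i' : ℕ) + 1 = i) : ξ i' ≤ μv i := by
  obtain ⟨m1, P, hP, -, rfl⟩ := hM
  obtain ⟨m2, Q, hQ, -, rfl⟩ := hT
  have hii : i' < i := by rw [Fin.lt_def]; omega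
  obtain ⟨x, hx, hk⟩ := exists_kernel
    (fun j => if j < i' then Qᵀ j else if j = i' then e else if i < j then Pᵀ j else 0) i
    (by simp [hii.ne', not_lt_of_gt hii])
  have hp := dot_pos hx
  have h1 := h x (by simpa using hk i')
  rw [quad, quad] at h1
  have h2 := low (μv := ξ) (ξ i') (Qᵀ *ᵥ x) (fun k => by
    rcases lt_or_ge k i' with hki | hki
    · left; have := hk k; simp only [hki, if_true] at this; exact this
    · right; exact m2 hki)
  have h3 := upp (μv := μv) (μv i) (Pᵀ *ᵥ x) (fun k => by
    rcases lt_or_ge i k with hki | hki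
    · left
      have := hk k
      have h4 := hii.trans hki
      simp only [hki, if_true, not_lt_of_gt h4, h4.ne', if_false] at this; exact this
    · right; exact m1 hki)
  rw [← normsq P hP] at h3
  rw [← normsq Q hQ] at h2
  exact le_of_mul_le_mul_right (h2.trans (h1.trans h3)) hp

lemma eig_ge {n : ℕ} {μv : Fin n → ℝ} {M : Matrix (Fin n) (Fin n) ℝ}
    (hM : GM.IsEigs μv M) (c : ℝ) (h : ∀ x, c * (x ⬝ᵥ x) ≤ x ⬝ᵥ (M *ᵥ x)) (i : Fin n) :
    c ≤ μv i := by
  obtain ⟨m1, P, hP, hP', rfl⟩ := hM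
  have h1 := h (P *ᵥ Pi.single i 1)
  rw [quad, normsq P hP, Matrix.mulVec_mulVec, hP', Matrix.one_mulVec] at h1
  simpa [Pi.single_apply] using h1

/-- lower shift -/
def L (n : ℕ) : Matrix (Fin n) (Fin n) ℝ :=
  Matrix.of fun i j => if (i : ℕ) = (j : ℕ) + 1 then 1 else 0

/-- last diagonal -/
def E (n : ℕ) : Matrix (Fin n) (Fin n) ℝ :=
  Matrix.diagonal fun i => if (i : ℕ) + 1 = n then 1 else 0

lemma Amat_eq (a : ℝ) (n : ℕ) : GM.Amat a n = 1 - a • L n := by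
  ext i j
  simp only [GM.Amat, L, Matrix.of_apply, Matrix.sub_apply, Matrix.smul_apply, Matrix.one_apply,
    smul_eq_mul]
  by_cases h : i = j
  · subst h; simp
  · simp only [h, if_false]; split_ifs <;> simp

lemma LTL (n : ℕ) : (L n)ᵀ * L n = 1 - E n := by
  ext i j
  simp only [L, E, Matrix.mul_apply, Matrix.transpose_apply, Matrix.of_apply, Matrix.sub_apply,
    Matrix.one_apply, Matrix.diagonal_apply]
  by_cases hi : (i : ℕ) + 1 < n
  · rw [Finset.sum_eq_single (⟨i + 1, hi⟩ : Fin n)]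
    · by_cases h : i = j
      · subst h; simp [hi.ne]
      · have : ¬ (i : ℕ) = j := fun h' => h (Fin.ext h')
        simp [h, this]
    · intro k _ hk
      have : ¬ (k : ℕ) = i + 1 := fun h' => hk (Fin.ext h')
      simp [this]
    · simp
  · have h1 : (i : ℕ) + 1 = n := by omega
    rw [Finset.sum_eq_zero]
    · by_cases h : i = j <;> simp [h1, h]
      subst h; simp [h1]
    · intro k _
      have : ¬ (k : ℕ) = i + 1 := by omega
      simp [this]

/-- Toeplitz -/
def T (a : ℝ) (n : ℕ) : Matrix (Fin n) (Fin n) ℝ := (1 + a ^ 2) • 1 - a • (L n + (L n)ᵀ)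

lemma M_eq (a : ℝ) (n : ℕ) : (GM.Amat a n)ᵀ * GM.Amat a n = T a n - a ^ 2 • E n := by
  have h : E n = 1 - (L n)ᵀ * L n := by rw [LTL]; abel
  rw [Amat_eq, h, T]
  simp only [Matrix.transpose_sub, Matrix.transpose_one, Matrix.transpose_smul, sub_mul, mul_sub,
    one_mul, mul_one, smul_mul_assoc, mul_smul_comm, smul_smul]
  module

lemma Equad (n : ℕ) (x : Fin n → ℝ) : x ⬝ᵥ (E n *ᵥ x) =
    ∑ i : Fin n, (if (i : ℕ) + 1 = n then (1 : ℝ) else 0) * x i ^ 2 := by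
  simp only [E, dotProduct, Matrix.mulVec_diagonal]
  exact Finset.sum_congr rfl fun k _ => by ring

lemma Mquad (a : ℝ) (n : ℕ) (x : Fin n → ℝ) :
    x ⬝ᵥ (((GM.Amat a n)ᵀ * GM.Amat a n) *ᵥ x) =
      x ⬝ᵥ (T a n *ᵥ x) - a ^ 2 * (x ⬝ᵥ (E n *ᵥ x)) := by
  rw [M_eq, Matrix.sub_mulVec, dotProduct_sub, Matrix.smul_mulVec, dotProduct_smul, smul_eq_mul]

lemma E_nonneg (n : ℕ) (x : Fin n → ℝ) : 0 ≤ x ⬝ᵥ (E n *ᵥ x) := by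
  rw [Equad]
  exact Finset.sum_nonneg fun i _ => by positivity

lemma M_ge (a : ℝ) (ha0 : 0 ≤ a) (ha1 : a < 1) (n : ℕ) (x : Fin n → ℝ) :
    (1 - a) ^ 2 * (x ⬝ᵥ x) ≤ x ⬝ᵥ (((GM.Amat a n)ᵀ * GM.Amat a n) *ᵥ x) := by
  set y := L n *ᵥ x with hy
  have hA : GM.Amat a n *ᵥ x = x - a • y := by
    rw [Amat_eq, Matrix.sub_mulVec, Matrix.one_mulVec, Matrix.smul_mulVec]
  have hY : y ⬝ᵥ y = x ⬝ᵥ x - x ⬝ᵥ (E n *ᵥ x) := by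
    have : y ⬝ᵥ y = x ⬝ᵥ (((L n)ᵀ * L n) *ᵥ x) := by
      rw [← Matrix.mulVec_mulVec, Matrix.dotProduct_mulVec x, Matrix.vecMul_transpose]
    rw [this, LTL, Matrix.sub_mulVec, dotProduct_sub, Matrix.one_mulVec]
  have hYX : y ⬝ᵥ y ≤ x ⬝ᵥ x := by linarith [E_nonneg n x]
  rw [← Matrix.mulVec_mulVec, Matrix.dotProduct_mulVec x, Matrix.vecMul_transpose, hA]
  have key : (1 - a) * (x ⬝ᵥ x) - a * (1 - a) * (y ⬝ᵥ y) ≤ (x - a • y) ⬝ᵥ (x - a • y) := by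
    simp only [dotProduct, Finset.mul_sum, ← Finset.sum_sub_distrib]
    refine Finset.sum_le_sum fun i _ => ?_
    simp only [Pi.sub_apply, Pi.smul_apply, smul_eq_mul]
    nlinarith [mul_nonneg ha0 (sq_nonneg (x i - y i))]
  nlinarith [mul_nonneg (mul_nonneg ha0 (sub_nonneg.2 ha1.le)) (sub_nonneg.2 hYX)]

/-- sines -/
def S (n : ℕ) : Matrix (Fin n) (Fin n) ℝ :=
  Matrix.of fun j k => Real.sin (((j : ℕ) + 1) * ((((k : ℕ) + 1) * π) / (n + 1)))

/-- angle -/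
def w (n : ℕ) (k : Fin n) : ℝ := (((k : ℕ) + 1) * π) / (n + 1)

lemma w_anti (n : ℕ) : StrictAnti (fun k => Real.cos (w n k)) := by
  have hw : ∀ k : Fin n, w n k ∈ Set.Icc 0 π := fun k => by
    have : ((k : ℕ) : ℝ) + 1 ≤ n := by exact_mod_cast k.2
    have hpi := Real.pi_pos
    refine ⟨by unfold w; positivity, ?_⟩
    unfold w
    rw [div_le_iff₀ (by positivity)]
    nlinarith
  intro k l h
  refine Real.strictAntiOn_cos (hw k) (hw l) ?_
  have : ((k : ℕ) : ℝ) < (l : ℕ) := by exact_mod_cast h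
  have hpi := Real.pi_pos
  unfold w
  gcongr

lemma L_mul (n : ℕ) (g : ℕ → ℝ) (g0 : g 0 = 0) (i : Fin n) :
    ∑ j : Fin n, L n i j * g ((j : ℕ) + 1) = g i := by
  rcases i with ⟨i, hi⟩
  cases i with
  | zero => simp [L, g0]
  | succ i =>
    rw [Finset.sum_eq_single (⟨i, by omega⟩ : Fin n)]
    · simp [L]
    · intro k _ hk
      have : ¬ i = (k : ℕ) := fun h' => hk (Fin.ext h'.symm)
      simp [L, this]
    · simp

lemma LT_mul (n : ℕ) (g : ℕ → ℝ) (g0 : g (n + 1) = 0) (i : Fin n) :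
    ∑ j : Fin n, (L n)ᵀ i j * g ((j : ℕ) + 1) = g (i + 2) := by
  by_cases hi : (i : ℕ) + 1 < n
  · rw [Finset.sum_eq_single (⟨i + 1, hi⟩ : Fin n)]
    · simp [L]
    · intro k _ hk
      have : ¬ (k : ℕ) = i + 1 := fun h' => hk (Fin.ext h')
      simp [L, this]
    · simp
  · have h1 : (i : ℕ) + 2 = n + 1 := by omega
    rw [h1, g0, Finset.sum_eq_zero]
    intro k _
    have : ¬ (k : ℕ) = i + 1 := by omega
    simp [L, this]

lemma C_S (n : ℕ) : (L n + (L n)ᵀ) * S n =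
    S n * Matrix.diagonal (fun k => 2 * Real.cos (w n k)) := by
  ext i k
  rw [add_mul, Matrix.add_apply, Matrix.mul_diagonal, Matrix.mul_apply, Matrix.mul_apply]
  let g : ℕ → ℝ := fun m => Real.sin ((m : ℝ) * w n k)
  have hS : ∀ j : Fin n, S n j k = g ((j : ℕ) + 1) := fun j => by
    simp [S, g, w]
  simp only [hS]
  rw [L_mul n g (by simp [g]), LT_mul n g]
  · simp only [g]
    push_cast
    rw [show ((i : ℕ) : ℝ) * w n k = (((i : ℕ) : ℝ) + 1) * w n k - w n k by ring,
      show (((i : ℕ) : ℝ) + 2) * w n k = (((i : ℕ) : ℝ) + 1) * w n k + w n k by ring,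
      Real.sin_sub, Real.sin_add]
    ring
  · simp only [g, w]
    have : (((n + 1 : ℕ) : ℝ)) * ((((k : ℕ) : ℝ) + 1) * π / (n + 1)) = ((k + 1 : ℕ) : ℝ) * π := by
      push_cast
      field_simp
    rw [this, Real.sin_nat_mul_pi]

lemma S_orth (n : ℕ) (k l : Fin n) (h : k ≠ l) : ((S n)ᵀ * S n) k l = 0 := by
  have h1 : (S n)ᵀ * ((L n + (L n)ᵀ) * S n) = ((L n + (L n)ᵀ) * S n)ᵀ * S n := by
    rw [Matrix.transpose_mul, Matrix.transpose_add, Matrix.transpose_transpose, Matrix.mul_assoc,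
      add_comm]
  rw [C_S, Matrix.transpose_mul, Matrix.diagonal_transpose, ← Matrix.mul_assoc,
    Matrix.mul_assoc] at h1
  have h2 := congrFun (congrFun h1 k) l
  rw [← Matrix.mul_assoc, Matrix.mul_assoc (Matrix.diagonal _), Matrix.mul_diagonal,
    Matrix.diagonal_mul] at h2
  have h3 : Real.cos (w n k) ≠ Real.cos (w n l) := fun h' => h ((w_anti n).injective h')
  have h4 : (2 * (Real.cos (w n k) - Real.cos (w n l))) * ((S n)ᵀ * S n) k l = 0 := by linarith
  rcases mul_eq_zero.1 h4 with h5 | h5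
  · exact absurd (by linarith) h3
  · exact h5

lemma S_pos (n : ℕ) (k : Fin n) : 0 < ((S n)ᵀ * S n) k k := by
  rw [Matrix.mul_apply]
  have hn : 0 < n := k.pos
  apply Finset.sum_pos' (fun i _ => mul_self_nonneg _) ⟨⟨0, hn⟩, Finset.mem_univ _, ?_⟩
  have : 0 < S n ⟨0, hn⟩ k := by
    simp only [S, Matrix.of_apply]
    have : ((k : ℕ) : ℝ) + 1 ≤ n := by exact_mod_cast k.2
    have hpi := Real.pi_pos
    apply Real.sin_pos_of_pos_of_lt_pi
    · positivity
    · simp only [Nat.cast_zero, zero_add, one_mul]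
      rw [div_lt_iff₀ (by positivity)]
      nlinarith
  exact mul_pos this this

lemma T_eigs (a : ℝ) (ha0 : 0 ≤ a) (n : ℕ) :
    GM.IsEigs (fun k => 1 + a ^ 2 - 2 * a * Real.cos (w n k)) (T a n) := by
  refine ⟨fun k l h => ?_, ?_⟩
  · have := mul_le_mul_of_nonneg_left ((w_anti n).antitone h) ha0
    simp only at this ⊢
    linarith
  let d : Fin n → ℝ := fun k => ((S n)ᵀ * S n) k k
  let r : Fin n → ℝ := fun k => (√(d k))⁻¹
  have hd : (S n)ᵀ * S n = Matrix.diagonal d := by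
    ext k l
    by_cases h : k = l
    · subst h; simp [d]
    · rw [S_orth n k l h, Matrix.diagonal_apply_ne _ h]
  have hPP : (S n * Matrix.diagonal r)ᵀ * (S n * Matrix.diagonal r) = 1 := by
    rw [Matrix.transpose_mul, Matrix.diagonal_transpose, Matrix.mul_assoc,
      ← Matrix.mul_assoc (S n)ᵀ, hd, Matrix.diagonal_mul_diagonal, Matrix.diagonal_mul_diagonal,
      ← Matrix.diagonal_one]
    congr 1
    ext k
    have hp : 0 < d k := S_pos n k
    have h1 := Real.mul_self_sqrt hp.le
    have h2 : √(d k) ≠ 0 := (Real.sqrt_pos.2 hp).ne'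
    simp only [r]
    field_simp
    nlinarith
  have hPP' := mul_eq_one_comm.1 hPP
  refine ⟨S n * Matrix.diagonal r, hPP', hPP, ?_⟩
  have hTS : T a n * S n =
      S n * Matrix.diagonal (fun k => 1 + a ^ 2 - 2 * a * Real.cos (w n k)) := by
    rw [T, sub_mul, smul_mul_assoc, smul_mul_assoc, C_S, one_mul]
    ext i k
    simp only [Matrix.sub_apply, Matrix.smul_apply, Matrix.mul_diagonal, smul_eq_mul]
    ring
  have hTP : T a n * (S n * Matrix.diagonal r) = (S n * Matrix.diagonal r) *
      Matrix.diagonal (fun k => 1 + a ^ 2 - 2 * a * Real.cos (w n k)) := by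
    rw [← Matrix.mul_assoc, hTS, Matrix.mul_assoc, Matrix.mul_assoc, Matrix.diagonal_mul_diagonal,
      Matrix.diagonal_mul_diagonal]
    simp only [mul_comm]
  rw [← hTP, Matrix.mul_assoc, hPP', mul_one]

end GMaux

theorem stmt6 (a : ℝ) (ha0 : 0 ≤ a) (ha1 : a < 1) (n : ℕ)
    (μv : Fin n → ℝ) (hμ : GM.IsEigs μv ((GM.Amat a n)ᵀ * GM.Amat a n)) (i : Fin n) :
    0 ≤ (1 + a ^ 2 - 2 * a * Real.cos (((i : ℕ) + 1) * π / (n + 1))) - μv i ∧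
    (1 + a ^ 2 - 2 * a * Real.cos (((i : ℕ) + 1) * π / (n + 1))) - μv i ≤ 2 * a * π / n := by
  have hT := GMaux.T_eigs a ha0 n
  refine ⟨sub_nonneg.2 (GMaux.weyl hμ hT (fun x => ?_) i), ?_⟩
  · rw [GMaux.Mquad]
    linarith [mul_nonneg (sq_nonneg a) (GMaux.E_nonneg n x)]
  have hn : 0 < n := i.pos
  have hn' : (0 : ℝ) < n := by exact_mod_cast hn
  have hpi := Real.pi_pos
  have hlow : 1 + a ^ 2 - 2 * a * Real.cos ((i : ℕ) * π / (n + 1)) ≤ μv i := by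
    by_cases h0 : (i : ℕ) = 0
    · have := GMaux.eig_ge hμ _ (GMaux.M_ge a ha0 ha1 n) i
      rw [h0]
      simp only [Nat.cast_zero, zero_mul, zero_div, Real.cos_zero]
      nlinarith
    · have h1 : ((i : ℕ) - 1) + 1 = (i : ℕ) := by omega
      have := GMaux.interlace hμ hT (fun j => if (j : ℕ) + 1 = n then 1 else 0) (fun x hx => ?_) i
        ⟨(i : ℕ) - 1, by omega⟩ h1
      · have h2 : (((i : ℕ) - 1 : ℕ) : ℝ) + 1 = (i : ℕ) := by exact_mod_cast h1
        simpa only [GMaux.w, h2] using this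
      · rw [GMaux.Mquad, GMaux.Equad]
        have : ∑ i : Fin n, (if (i : ℕ) + 1 = n then (1 : ℝ) else 0) * x i ^ 2 = 0 := by
          have hl : ∀ j : Fin n, (j : ℕ) + 1 = n → x j = 0 := by
            intro j hj
            simp only [dotProduct] at hx
            rw [Finset.sum_eq_single j] at hx
            · simpa [hj] using hx
            · intro k _ hk
              have : ¬ (k : ℕ) + 1 = n := fun h' => hk (Fin.ext (by omega))
              simp [this]
            · simp
          refine Finset.sum_eq_zero fun j _ => ?_
          by_cases hj : (j : ℕ) + 1 = n
          · simp [hl j hj]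
          · simp [hj]
        rw [this]
        simp
  have hcos : Real.cos ((i : ℕ) * π / (n + 1)) - Real.cos (((i : ℕ) + 1) * π / (n + 1)) ≤ π / n := by
    have h1 := Real.abs_cos_sub_cos_le ((i : ℕ) * π / (n + 1)) (((i : ℕ) + 1) * π / (n + 1))
    have h2 : ((i : ℕ) : ℝ) * π / (n + 1) - (((i : ℕ) : ℝ) + 1) * π / (n + 1) = - (π / (n + 1)) := by
      ring
    have h3 : 0 < π / ((n : ℝ) + 1) := by positivity
    rw [h2, abs_neg, abs_of_pos h3] at h1
    refine (le_abs_self _).trans (h1.trans ?_)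
    gcongr
    linarith
  have := mul_le_mul_of_nonneg_left hcos (by positivity : 0 ≤ 2 * a)
  rw [mul_div_assoc (2 * a)]
  linarith

end
end

section
/- Fix a ∈ [0,1). For every n ∈ ℕ and every i ∈ {1, …, n}, the eigenvalues μ_i of AᵀA satisfy (1 − a)² ≤ μ_i ≤ (1 + a)², where A is the n×n lower-bidiagonal matrix with 1 on the diagonal and −a on the first subdiagonal. -/
open MeasureTheory ProbabilityTheory Real Filter Matrix
open scoped NNReal ENNReal

noncomputable section

theorem amat_zero (a : ℝ) (m : ℕ) (p : Fin (m+1) → ℝ) :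
    (GM.Amat a (m+1) *ᵥ p) 0 = p 0 := by
  have h : ∀ l : Fin (m+1), GM.Amat a (m+1) 0 l = if l = 0 then 1 else 0 := by
    intro l
    simp [GM.Amat, eq_comm]
  simp [Matrix.mulVec, dotProduct, h]

theorem amat_succ (a : ℝ) (m : ℕ) (p : Fin (m+1) → ℝ) (j : Fin m) :
    (GM.Amat a (m+1) *ᵥ p) j.succ = p j.succ - a * p j.castSucc := by
  have h : ∀ l : Fin (m+1), GM.Amat a (m+1) j.succ l =
      (if l = j.succ then 1 else 0) + (if l = j.castSucc then -a else 0) := by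
    intro l
    simp only [GM.Amat, Matrix.of_apply, Fin.ext_iff, Fin.val_succ, Fin.val_castSucc]
    split_ifs <;> first | omega | simp
  simp [Matrix.mulVec, dotProduct, h, add_mul, Finset.sum_add_distrib]
  ring

theorem amat_bounds (a : ℝ) (ha0 : 0 ≤ a) (ha1 : a < 1) (m : ℕ) (p : Fin (m+1) → ℝ)
    (hp : ∑ k, p k ^ 2 = 1) :
    (1 - a) ^ 2 ≤ ∑ k, (GM.Amat a (m+1) *ᵥ p) k ^ 2 ∧
      ∑ k, (GM.Amat a (m+1) *ᵥ p) k ^ 2 ≤ (1 + a) ^ 2 := by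
  have hs := hp
  have hc := hp
  rw [Fin.sum_univ_succ] at hs
  rw [Fin.sum_univ_castSucc] at hc
  rw [Fin.sum_univ_succ, amat_zero]
  simp only [amat_succ]
  have hl := sq_nonneg (p (Fin.last m))
  have hz := sq_nonneg (p 0)
  set X := ∑ i : Fin m, p i.succ ^ 2 with hX
  set Y := ∑ i : Fin m, p i.castSucc ^ 2 with hY
  have up : ∑ j : Fin m, (p j.succ - a * p j.castSucc) ^ 2 ≤ (1 + a) * X + (a + a ^ 2) * Y := by
    rw [hX, hY, Finset.mul_sum, Finset.mul_sum, ← Finset.sum_add_distrib]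
    refine Finset.sum_le_sum fun j _ => ?_
    nlinarith [mul_nonneg ha0 (sq_nonneg (p j.succ + p j.castSucc))]
  have lo : (1 - a) * X - (a - a ^ 2) * Y ≤ ∑ j : Fin m, (p j.succ - a * p j.castSucc) ^ 2 := by
    rw [hX, hY, Finset.mul_sum, Finset.mul_sum, ← Finset.sum_sub_distrib]
    refine Finset.sum_le_sum fun j _ => ?_
    nlinarith [mul_nonneg ha0 (sq_nonneg (p j.succ - p j.castSucc))]
  have hXe : X = 1 - p 0 ^ 2 := by linarith
  have hYe : Y = 1 - p (Fin.last m) ^ 2 := by linarith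
  rw [hXe, hYe] at up lo
  have h1 := mul_nonneg ha0 hz
  have h2 := mul_nonneg ha0 hl
  have h3 := mul_nonneg (mul_nonneg ha0 ha0) hl
  have h4 := mul_nonneg (mul_nonneg ha0 (sub_nonneg.2 ha1.le)) hl
  constructor <;> nlinarith

theorem stmt7 (a : ℝ) (ha0 : 0 ≤ a) (ha1 : a < 1) (n : ℕ)
    (μv : Fin n → ℝ) (hμ : GM.IsEigs μv ((GM.Amat a n)ᵀ * GM.Amat a n)) (i : Fin n) :
    (1 - a) ^ 2 ≤ μv i ∧ μv i ≤ (1 + a) ^ 2 := by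
  obtain ⟨-, P, -, hP, hM⟩ := hμ
  cases n with
  | zero => exact i.elim0
  | succ m =>
  have hp : ∑ k, (fun k => P k i) k ^ 2 = 1 := by
    have := congrFun (congrFun hP i) i
    simpa [Matrix.mul_apply, pow_two] using this
  have key : (GM.Amat a (m+1) * P)ᵀ * (GM.Amat a (m+1) * P) = Matrix.diagonal μv := by
    calc _ = Pᵀ * ((GM.Amat a (m+1))ᵀ * GM.Amat a (m+1)) * P := by
            simp only [Matrix.transpose_mul, Matrix.mul_assoc]
      _ = (Pᵀ * P) * Matrix.diagonal μv * (Pᵀ * P) := by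
            rw [hM]; simp only [Matrix.mul_assoc]
      _ = _ := by rw [hP]; simp
  have hμi : ∑ k, (GM.Amat a (m+1) *ᵥ (fun k => P k i)) k ^ 2 = μv i := by
    have := congrFun (congrFun key i) i
    rw [Matrix.diagonal_apply_eq, Matrix.mul_apply] at this
    rw [← this]
    refine Finset.sum_congr rfl fun k _ => ?_
    rw [pow_two]; rfl
  rw [← hμi]
  exact amat_bounds a ha0 ha1 m _ hp

end
end

section
/- Fix a ∈ [0,1) and σ > 0. There exists a constant κ > 0 (depending only on a) such that for every constant α > 0, with η_n = √(α·log log n / n), for all sufficiently large n the maximum likelihood estimator satisfies P[ |â(U^n) − a| > η_n ] ≤ 2/(log n)^{κα}, where U^n is the n-sample vector of the Gauss-Markov source. -/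
open MeasureTheory ProbabilityTheory Real Filter Matrix
open scoped NNReal ENNReal

noncomputable section

namespace GMaux

lemma gauss_lint (v : ℝ≥0) (hv : 0 < v) (q c : ℝ) (hq : 0 ≤ q) :
    ∫⁻ z, ENNReal.ofReal (Real.exp (c * z - q * z ^ 2)) ∂(gaussianReal 0 v) =
      ENNReal.ofReal ((√(1 + 2 * q * v))⁻¹ * Real.exp (c ^ 2 * v / (2 * (1 + 2 * q * v)))) := by
  have hv' : (0 : ℝ) < v := hv
  have hD : 0 < 1 + 2 * q * (v : ℝ) := by positivity
  set D : ℝ := 1 + 2 * q * (v : ℝ) with hDdef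
  set w : ℝ≥0 := v / ⟨D, hD.le⟩ with hw
  have hwv : (w : ℝ) = v / D := by rw [hw]; rfl
  have hw0 : w ≠ 0 := by
    have : (0 : ℝ) < w := by rw [hwv]; positivity
    exact (show (0 : ℝ≥0) < w from this).ne'
  rw [gaussianReal_of_var_ne_zero _ hv.ne',
    lintegral_withDensity_eq_lintegral_mul _ (measurable_gaussianPDF _ _) (by fun_prop)]
  have key : ∀ z, (gaussianPDF 0 v * fun z => ENNReal.ofReal (Real.exp (c * z - q * z ^ 2))) z
      = ENNReal.ofReal ((√D)⁻¹ * Real.exp (c ^ 2 * v / (2 * D))) * gaussianPDF (c * w) w z := by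
    intro z
    simp only [Pi.mul_apply, gaussianPDF]
    rw [← ENNReal.ofReal_mul (gaussianPDFReal_nonneg _ _ _), ← ENNReal.ofReal_mul (by positivity)]
    congr 1
    simp only [gaussianPDFReal]
    have h1 : √(2 * π * (v : ℝ)) = √D * √(2 * π * (w : ℝ)) := by
      rw [← Real.sqrt_mul hD.le, hwv]
      congr 1
      field_simp
    rw [h1, mul_inv, mul_assoc, ← Real.exp_add]
    have h2 : -(z - 0) ^ 2 / (2 * (v : ℝ)) + (c * z - q * z ^ 2)
      = c ^ 2 * v / (2 * D) + -(z - c * w) ^ 2 / (2 * (w : ℝ)) := by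
      rw [hwv]
      field_simp
      rw [hDdef]
      ring
    rw [h2, Real.exp_add]
    ring
  simp_rw [key]
  rw [lintegral_const_mul _ (measurable_gaussianPDF _ _), lintegral_gaussianPDF_eq_one _ hw0, mul_one]

lemma one_step (v : ℝ≥0) (hv : 0 < v) (a s r q' q x : ℝ) (hq : 0 ≤ q')
    (H : q + v * (s - 2 * q' * a) ^ 2 / 2 ≤ r) :
    ∫⁻ z, ENNReal.ofReal (Real.exp (s * (x * z) - r * x ^ 2 - q' * (a * x + z) ^ 2))
        ∂(gaussianReal 0 v) ≤
      ENNReal.ofReal ((√(1 + 2 * q' * v))⁻¹ * Real.exp (-q * x ^ 2)) := by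
  have h : ∀ z, ENNReal.ofReal (Real.exp (s * (x * z) - r * x ^ 2 - q' * (a * x + z) ^ 2)) =
    ENNReal.ofReal (Real.exp (-r * x ^ 2 - q' * a ^ 2 * x ^ 2)) *
      ENNReal.ofReal (Real.exp ((s * x - 2 * q' * a * x) * z - q' * z ^ 2)) := by
    intro z
    rw [← ENNReal.ofReal_mul (by positivity), ← Real.exp_add]
    congr 2
    ring
  simp_rw [h]
  rw [lintegral_const_mul _ (by fun_prop), gauss_lint v hv _ _ hq,
    ← ENNReal.ofReal_mul (by positivity)]
  apply ENNReal.ofReal_le_ofReal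
  rw [mul_left_comm, ← Real.exp_add]
  gcongr
  have hv' : (0 : ℝ) < v := hv
  have hD : 1 ≤ 1 + 2 * q' * (v : ℝ) := by
    have : 0 ≤ 2 * q' * (v : ℝ) := by positivity
    linarith
  have h3 : (s * x - 2 * q' * a * x) ^ 2 * v / (2 * (1 + 2 * q' * v)) ≤
      (v * (s - 2 * q' * a) ^ 2 / 2) * x ^ 2 := by
    have : (v * (s - 2 * q' * a) ^ 2 / 2) * x ^ 2 = (s * x - 2 * q' * a * x) ^ 2 * v / (2 * 1) := by
      ring
    rw [this]
    gcongr
  have h4 := mul_le_mul_of_nonneg_right H (sq_nonneg x)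
  have h5 : 0 ≤ q' * a ^ 2 * x ^ 2 := by positivity
  nlinarith

def U (a x : ℝ) (z : ℕ → ℝ) : ℕ → ℝ
  | 0 => x
  | k + 1 => a * U a x z k + z k

lemma U_shift (a x : ℝ) (z : ℕ → ℝ) (k : ℕ) :
    U a x z (k + 1) = U a (a * x + z 0) (fun i => z (i + 1)) k := by
  induction k with
  | zero => rfl
  | succ k ih => rw [U, ih]; rfl

def G (a s r : ℝ) (n : ℕ) (x : ℝ) (z : ℕ → ℝ) : ℝ :=
  ∑ k ∈ Finset.range n, (s * (U a x z k * z k) - r * U a x z k ^ 2)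

lemma G_succ (a s r : ℝ) (n : ℕ) (x : ℝ) (z : ℕ → ℝ) :
    G a s r (n + 1) x z =
      s * (x * z 0) - r * x ^ 2 + G a s r n (a * x + z 0) (fun i => z (i + 1)) := by
  rw [G, Finset.sum_range_succ', add_comm]
  simp only [U_shift]
  rfl

lemma entry_cons_zero {n : ℕ} (t : ℝ) (y : Fin n → ℝ) :
    GM.entry (Fin.cons t y : Fin (n + 1) → ℝ) 0 = t := by
  simp [GM.entry]

lemma entry_cons_succ {n : ℕ} (t : ℝ) (y : Fin n → ℝ) (k : ℕ) :
    GM.entry (Fin.cons t y : Fin (n + 1) → ℝ) (k + 1) = GM.entry y k := by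
  unfold GM.entry
  by_cases h : k < n
  · simp only [h, Nat.add_lt_add_iff_right, dif_pos]
    exact Fin.cons_succ (α := fun _ => ℝ) t y ⟨k, h⟩
  · simp [h]

@[fun_prop]
lemma meas_entry {n : ℕ} (k : ℕ) : Measurable (fun z : Fin n → ℝ => GM.entry z k) := by
  unfold GM.entry
  by_cases h : k < n
  · simp only [h, dif_pos]; fun_prop
  · simp [h]

lemma meas_U {n : ℕ} (a x : ℝ) (k : ℕ) :
    Measurable (fun z : Fin n → ℝ => U a x (GM.entry z) k) := by
  induction k with
  | zero => simp [U]
  | succ k ih => simp only [U]; fun_prop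

lemma meas_G {n : ℕ} (a s r x : ℝ) (m : ℕ) :
    Measurable (fun z : Fin n → ℝ => G a s r m x (GM.entry z)) := by
  unfold G
  have := fun k => meas_U (n := n) a x k
  fun_prop

lemma lint_succ (μ : Measure ℝ) [IsProbabilityMeasure μ] (n : ℕ) (f : (Fin (n + 1) → ℝ) → ℝ≥0∞)
    (hf : Measurable f) :
    ∫⁻ z, f z ∂(Measure.pi fun _ : Fin (n + 1) => μ) =
      ∫⁻ t, ∫⁻ y, f (Fin.cons t y) ∂(Measure.pi fun _ : Fin n => μ) ∂μ := by
  have h := (measurePreserving_piFinSuccAbove (fun _ : Fin (n + 1) => μ) 0).symm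
  rw [← h.lintegral_comp hf, lintegral_prod _ (by
    exact (hf.comp (MeasurableEquiv.measurable _)).aemeasurable)]
  have e : ∀ (t : ℝ) (y : Fin n → ℝ),
      (MeasurableEquiv.piFinSuccAbove (fun _ : Fin (n + 1) => ℝ) 0).symm (t, y) = Fin.cons t y := by
    intro t y
    change Fin.insertNth (α := fun _ : Fin (n + 1) => ℝ) 0 t y = _
    exact Fin.insertNth_zero' t y
  simp only [e]

lemma main_bound (v : ℝ≥0) (hv : 0 < v) (a s r q : ℝ) (hq : 0 ≤ q)
    (H0 : q + v * s ^ 2 / 2 ≤ r) (H : q + v * (s - 2 * q * a) ^ 2 / 2 ≤ r) (n : ℕ) : ∀ x : ℝ,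
    ∫⁻ z, ENNReal.ofReal (Real.exp (G a s r (n + 1) x (GM.entry z)))
      ∂(Measure.pi fun _ : Fin (n + 1) => gaussianReal 0 v) ≤
      ENNReal.ofReal ((√(1 + 2 * q * v))⁻¹ ^ n * Real.exp (-q * x ^ 2)) := by
  induction n with
  | zero =>
    intro x
    rw [lint_succ _ _ _ (by have := meas_G (n := 1) a s r x 1; fun_prop)]
    have := one_step v hv a s r 0 q x le_rfl (by simpa using H0)
    simp_rw [G_succ _ _ _ 0, entry_cons_zero]
    simp only [G, Finset.range_zero, Finset.sum_empty]
    simpa using this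
  | succ n ih =>
    intro x
    rw [lint_succ _ _ _ (by have := meas_G (n := n + 2) a s r x (n + 2); fun_prop)]
    simp_rw [G_succ _ _ _ (n + 1), entry_cons_zero, entry_cons_succ]
    calc _ ≤ ∫⁻ t, ENNReal.ofReal ((√(1 + 2 * q * v))⁻¹ ^ n) *
          ENNReal.ofReal (Real.exp (s * (x * t) - r * x ^ 2 - q * (a * x + t) ^ 2))
          ∂(gaussianReal 0 v) := by
          apply lintegral_mono
          intro t
          simp only [Real.exp_add _ (G _ _ _ _ _ _), ENNReal.ofReal_mul (Real.exp_nonneg _)]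
          rw [lintegral_const_mul _ (by
            have := meas_G (n := n + 1) a s r (a * x + t) (n + 1); fun_prop)]
          refine (mul_le_mul_right (ih (a * x + t)) _).trans (le_of_eq ?_)
          rw [← ENNReal.ofReal_mul (by positivity), ← ENNReal.ofReal_mul (by positivity),
            mul_left_comm, ← Real.exp_add]
          congr 3
          ring
      _ ≤ _ := by
          rw [lintegral_const_mul _ (by fun_prop)]
          refine (mul_le_mul_right (one_step v hv a s r q q x hq H) _).trans (le_of_eq ?_)
          rw [← ENNReal.ofReal_mul (by positivity)]
          congr 1
          ring

lemma entry_evolve (a : ℝ) {n : ℕ} (z : Fin n → ℝ) (i : ℕ) (hi : i < n) :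
    GM.entry (GM.evolve a n z) i = ∑ j ∈ Finset.range (i + 1), a ^ (i - j) * GM.entry z j := by
  simp only [GM.entry, hi, dif_pos, GM.evolve]
  refine Finset.sum_bij (fun j _ => (j : ℕ)) ?_ ?_ ?_ ?_
  · intro j hj
    simp only [Finset.mem_Iic, Fin.le_def] at hj
    simp only [Finset.mem_range]; omega
  · intro j _ k _ h
    exact Fin.ext h
  · intro j hj
    simp only [Finset.mem_range] at hj
    exact ⟨⟨j, by omega⟩, by simp only [Finset.mem_Iic, Fin.le_def]; omega, rfl⟩
  · intro j _
    simp [j.2]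

lemma evolve_U (a : ℝ) {n : ℕ} (z : Fin n → ℝ) (i : ℕ) (hi : i < n) :
    GM.entry (GM.evolve a n z) i = U a 0 (GM.entry z) (i + 1) := by
  induction i with
  | zero => rw [entry_evolve a z 0 hi]; simp [U]
  | succ i ih =>
    rw [U, ← ih (by omega), entry_evolve a z _ hi, entry_evolve a z i (by omega),
      Finset.sum_range_succ, Finset.mul_sum]
    congr 1
    · refine Finset.sum_congr rfl fun j hj => ?_
      simp only [Finset.mem_range] at hj
      rw [show i + 1 - j = (i - j) + 1 by omega, pow_succ]
      ring
    · simp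

lemma G_evolve (a s r : ℝ) (n : ℕ) (z : Fin (n + 1) → ℝ) :
    G a s r (n + 1) 0 (GM.entry z) =
      s * (∑ i ∈ Finset.range n, GM.entry (GM.evolve a (n + 1) z) i *
        GM.entry (GM.evolve a (n + 1) z) (i + 1)
        - a * ∑ i ∈ Finset.range n, GM.entry (GM.evolve a (n + 1) z) i ^ 2)
      - r * ∑ i ∈ Finset.range n, GM.entry (GM.evolve a (n + 1) z) i ^ 2 := by
  rw [G, Finset.sum_range_succ', Finset.mul_sum, Finset.mul_sum, ← Finset.sum_sub_distrib,
    Finset.mul_sum, ← Finset.sum_sub_distrib]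
  simp only [U, zero_mul, mul_zero, sub_zero, add_zero, ne_eq, OfNat.ofNat_ne_zero,
    not_false_eq_true, zero_pow]
  refine Finset.sum_congr rfl fun i hi => ?_
  simp only [Finset.mem_range] at hi
  have h1 := evolve_U a z i (by omega)
  have h2 := evolve_U a z (i + 1) (by omega)
  rw [h2, h1]
  simp only [U]
  ring

lemma meas_evolve (a : ℝ) (n : ℕ) : Measurable (GM.evolve a n) := by
  unfold GM.evolve
  fun_prop

lemma meas_mle (n : ℕ) : Measurable (fun u : Fin n → ℝ => GM.mle u) := by
  unfold GM.mle
  fun_prop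

lemma half_bound (v : ℝ≥0) (hv : 0 < v) (a s η : ℝ) (ha0 : 0 ≤ a) (ha1 : a < 1) (hη : 0 ≤ η)
    (hη1 : η ≤ 1) (hs : s = η / v ∨ s = -(η / v)) (n : ℕ) :
    (Measure.pi fun _ : Fin (n + 1) => gaussianReal 0 v)
      {z | 0 ≤ G a s (η ^ 2 / v) (n + 1) 0 (GM.entry z)} ≤
      ENNReal.ofReal (Real.exp (-(η ^ 2 / 16) * n)) := by
  have hv' : (0 : ℝ) < v := hv
  have hs2 : s ^ 2 = η ^ 2 / v ^ 2 := by rcases hs with h | h <;> rw [h] <;> ring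
  have hsa : -(η / v) ≤ s := by
    have : 0 ≤ η / v := by positivity
    rcases hs with h | h <;> linarith
  have hH : η ^ 2 / (8 * v) + v * (s - 2 * (η ^ 2 / (8 * v)) * a) ^ 2 / 2 ≤ η ^ 2 / v := by
    have hb : |s - 2 * (η ^ 2 / (8 * v)) * a| ≤ 5 / 4 * (η / v) := by
      have h1 : 2 * (η ^ 2 / (8 * v)) * a = (η / v) * (η * a / 4) := by field_simp; ring
      have h2 : 0 ≤ η * a / 4 := by positivity
      have h3 : η * a / 4 ≤ 1 / 4 := by nlinarith
      have h4 : 0 ≤ η / v := by positivity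
      rw [h1, abs_le]
      rcases hs with h | h <;> rw [h] <;> constructor <;> nlinarith
    have hb2 : (s - 2 * (η ^ 2 / (8 * v)) * a) ^ 2 ≤ (5 / 4 * (η / v)) ^ 2 := by
      rw [← sq_abs]; gcongr
    calc _ ≤ η ^ 2 / (8 * v) + v * (5 / 4 * (η / v)) ^ 2 / 2 := by gcongr
      _ = (29 / 32) * (η ^ 2 / v) := by field_simp; ring
      _ ≤ _ := by
        have : 0 ≤ η ^ 2 / v := by positivity
        linarith
  have hH0 : η ^ 2 / (8 * v) + v * s ^ 2 / 2 ≤ η ^ 2 / v := by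
    rw [hs2]
    have e : η ^ 2 / (8 * v) + v * (η ^ 2 / v ^ 2) / 2 = (5 / 8) * (η ^ 2 / v) := by
      field_simp; ring
    rw [e]
    have : 0 ≤ η ^ 2 / v := by positivity
    linarith
  have hm := main_bound v hv a s (η ^ 2 / v) (η ^ 2 / (8 * v)) (by positivity) hH0 hH n 0
  have hmk := mul_meas_ge_le_lintegral₀
    (μ := (Measure.pi fun _ : Fin (n + 1) => gaussianReal 0 v))
    (f := fun z => ENNReal.ofReal (Real.exp (G a s (η ^ 2 / v) (n + 1) 0 (GM.entry z))))
    (by have := meas_G (n := n + 1) a s (η ^ 2 / v) 0 (n + 1); exact (by fun_prop : Measurable _).aemeasurable) 1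
  rw [one_mul] at hmk
  refine (measure_mono ?_).trans (hmk.trans (hm.trans (ENNReal.ofReal_le_ofReal ?_)))
  · intro z hz
    simp only [Set.mem_ofPred_eq] at hz ⊢
    rw [ENNReal.one_le_ofReal]
    exact Real.one_le_exp hz
  · have e1 : 1 + 2 * (η ^ 2 / (8 * v)) * (v : ℝ) = 1 + η ^ 2 / 4 := by field_simp; ring
    rw [e1]
    have h8 : Real.exp (η ^ 2 / 8) ≤ 1 + η ^ 2 / 4 := by
      have hx : |η ^ 2 / 8| ≤ 1 := by rw [abs_of_nonneg (by positivity)]; nlinarith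
      have := Real.abs_exp_sub_one_le hx
      rw [abs_of_nonneg (show 0 ≤ η ^ 2 / 8 by positivity)] at this
      linarith [le_abs_self (Real.exp (η ^ 2 / 8) - 1)]
    have h16 : (√(1 + η ^ 2 / 4))⁻¹ ≤ Real.exp (-(η ^ 2 / 16)) := by
      rw [Real.exp_neg]
      gcongr
      apply Real.le_sqrt_of_sq_le
      rw [← Real.exp_nat_mul]
      refine le_trans (le_of_eq ?_) h8
      congr 1
      push_cast; ring
    have h17 := pow_le_pow_left₀ (by positivity) h16 n
    rw [← Real.exp_nat_mul] at h17
    simp only [ne_eq, OfNat.ofNat_ne_zero, not_false_eq_true, zero_pow, mul_zero, Real.exp_zero,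
      mul_one]
    rwa [mul_comm (-(η ^ 2 / 16))]

lemma full_bound (a σ η : ℝ) (ha0 : 0 ≤ a) (ha1 : a < 1) (hσ : 0 < σ) (hη : 0 ≤ η)
    (hη1 : η ≤ 1) (n : ℕ) :
    GM.sourceLaw a σ (n + 1) {u | η < |GM.mle u - a|} ≤
      ENNReal.ofReal (2 * Real.exp (-(η ^ 2 / 16) * n)) := by
  have hms : MeasurableSet {u : Fin (n + 1) → ℝ | η < |GM.mle u - a|} := by
    have := meas_mle (n + 1)
    exact measurableSet_lt measurable_const (by fun_prop)
  rw [GM.sourceLaw, Measure.map_apply (meas_evolve a _) hms, GM.gaussPi]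
  set v : ℝ≥0 := ⟨σ ^ 2, sq_nonneg σ⟩ with hvdef
  have hv' : (0 : ℝ) < v := by change 0 < σ ^ 2; positivity
  have hv : 0 < v := hv'
  have h1 := half_bound v hv a (η / v) η ha0 ha1 hη hη1 (Or.inl rfl) n
  have h2 := half_bound v hv a (-(η / v)) η ha0 ha1 hη hη1 (Or.inr rfl) n
  rw [two_mul, ENNReal.ofReal_add (by positivity) (by positivity)]
  refine le_trans (measure_mono ?_) ((measure_union_le _ _).trans (add_le_add h1 h2))
  intro z hz
  simp only [Set.mem_preimage, Set.mem_ofPred_eq, Set.mem_union, G_evolve] at hz ⊢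
  rw [GM.mle, Nat.add_sub_cancel] at hz
  set S := ∑ i ∈ Finset.range n, GM.entry (GM.evolve a (n + 1) z) i ^ 2 with hS
  set N := ∑ i ∈ Finset.range n, GM.entry (GM.evolve a (n + 1) z) i *
        GM.entry (GM.evolve a (n + 1) z) (i + 1) with hN
  have hS0 : 0 ≤ S := Finset.sum_nonneg fun i _ => sq_nonneg _
  have hw : 0 ≤ η / (v : ℝ) := by positivity
  have hr : η ^ 2 / (v : ℝ) = η / v * η := by ring
  rw [hr]
  rcases hS0.eq_or_lt with h0 | hpos
  · have hN0 : N = 0 := by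
      rw [hN]
      refine Finset.sum_eq_zero fun i hi => ?_
      have := (Finset.sum_eq_zero_iff_of_nonneg (fun i _ => sq_nonneg _)).1 h0.symm i hi
      rw [pow_eq_zero_iff (by norm_num)] at this
      rw [this, zero_mul]
    left
    rw [hN0, ← h0]; simp
  · rcases lt_abs.1 hz with h | h
    · left
      have : η * S ≤ N - a * S := by
        have := mul_le_mul_of_nonneg_right h.le hS0
        rwa [sub_mul, div_mul_cancel₀ _ hpos.ne'] at this
      have := mul_le_mul_of_nonneg_left this hw
      linarith
    · right
      have : η * S ≤ -(N - a * S) := by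
        have := mul_le_mul_of_nonneg_right h.le hS0
        rwa [neg_mul, sub_mul, div_mul_cancel₀ _ hpos.ne'] at this
      have := mul_le_mul_of_nonneg_left this hw
      linarith

lemma loglog_tendsto (α : ℝ) :
    Tendsto (fun n : ℕ => α * Real.log (Real.log n) / n) atTop (nhds 0) := by
  have h1 : (fun x : ℝ => Real.log (Real.log x)) =o[atTop] (fun x : ℝ => x) := by
    have h := Real.isLittleO_log_id_atTop.comp_tendsto Real.tendsto_log_atTop
    exact h.trans Real.isLittleO_log_id_atTop
  have h2 := (h1.tendsto_div_nhds_zero.const_mul α).comp tendsto_natCast_atTop_atTop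
  simp only [mul_zero] at h2
  refine h2.congr fun n => ?_
  simp only [Function.comp]
  ring

end GMaux

theorem stmt9 (a σ : ℝ) (ha0 : 0 ≤ a) (ha1 : a < 1) (hσ : 0 < σ) :
    ∃ κ : ℝ, 0 < κ ∧ ∀ α : ℝ, 0 < α →
      ∀ᶠ n : ℕ in Filter.atTop,
        GM.sourceLaw a σ n
            {u | Real.sqrt (α * Real.log (Real.log n) / n) < |GM.mle u - a|} ≤
          ENNReal.ofReal (2 / Real.log n ^ (κ * α)) := by
  refine ⟨1 / 32, by norm_num, fun α hα => ?_⟩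
  have hlog : Tendsto (fun n : ℕ => Real.log n) atTop atTop :=
    Real.tendsto_log_atTop.comp tendsto_natCast_atTop_atTop
  filter_upwards [eventually_ge_atTop 2, hlog.eventually_ge_atTop 1,
    (GMaux.loglog_tendsto α).eventually_le_const zero_lt_one] with n hn hl hle
  obtain ⟨m, rfl⟩ : ∃ m, n = m + 1 := ⟨n - 1, by omega⟩
  have hll : 0 ≤ Real.log (Real.log ((m + 1 : ℕ) : ℝ)) := Real.log_nonneg hl
  have hE : 0 ≤ α * Real.log (Real.log ((m + 1 : ℕ) : ℝ)) / ((m + 1 : ℕ) : ℝ) := by positivity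
  refine (GMaux.full_bound a σ _ ha0 ha1 hσ (Real.sqrt_nonneg _)
    ((Real.sqrt_le_sqrt hle).trans (le_of_eq Real.sqrt_one)) m).trans (ENNReal.ofReal_le_ofReal ?_)
  rw [Real.sq_sqrt hE, div_eq_mul_inv 2, ← Real.rpow_neg (by linarith),
    Real.rpow_def_of_pos (by linarith)]
  refine mul_le_mul_of_nonneg_left (Real.exp_le_exp.2 ?_) zero_le_two
  have hm : (1 : ℝ) ≤ m := by
    have : 1 ≤ m := by omega
    exact_mod_cast this
  set L := Real.log (Real.log ((m + 1 : ℕ) : ℝ))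
  have hfrac : 1 / 2 ≤ (m : ℝ) / ((m + 1 : ℕ) : ℝ) := by
    push_cast
    rw [div_le_div_iff₀ (by norm_num) (by linarith)]
    linarith
  have e : -(α * L / ((m + 1 : ℕ) : ℝ) / 16) * m = -(α * L / 16) * ((m : ℝ) / ((m + 1 : ℕ) : ℝ)) := by
    ring
  rw [e]
  have : 0 ≤ α * L := by positivity
  nlinarith

end
end

section
/- Fix a ∈ [0,1), σ > 0, ε ∈ (0,1) and d ∈ (0, d_max). Then there exists a constant C > 0 such that for all sufficiently large n, the minimum achievable source coding rate of the Gauss-Markov source satisfies R(n, d, ε) ≥ R_U(d) + √(V_U(d)/n)·Q⁻¹(ε) − (log n)/(2n) − C/n. -/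
open MeasureTheory ProbabilityTheory Real Filter Matrix
open scoped NNReal ENNReal

noncomputable section

abbrev gam : Measure ℝ := gaussianReal 0 1

lemma integrable_gam_iff (f : ℝ → ℝ) :
    Integrable f gam ↔ Integrable (fun x => gaussianPDFReal 0 1 x * f x) := by
  rw [gam, gaussianReal_of_var_ne_zero _ one_ne_zero]
  rw [integrable_withDensity_iff_integrable_smul' (measurable_gaussianPDF 0 1)
    (by filter_upwards with x using gaussianPDF_lt_top)]
  simp [toReal_gaussianPDF]

lemma integral_gam (f : ℝ → ℝ) :
    ∫ x, f x ∂gam = ∫ x, gaussianPDFReal 0 1 x * f x := by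
  rw [gam, integral_gaussianReal_eq_integral_smul one_ne_zero]; simp

lemma integrable_pow_gam (k : ℕ) : Integrable (fun x : ℝ => x ^ k) gam := by
  have := (memLp_id_gaussianReal (μ := 0) (v := 1) (k : ℝ≥0)).integrable_norm_pow'
  refine (integrable_norm_iff (by fun_prop)).1 ?_
  simpa using this

lemma phi_eq : gaussianPDFReal 0 1 = fun x : ℝ => (√(2 * π))⁻¹ * rexp (-(x ^ 2) / 2) := by
  rw [gaussianPDFReal_def]; simp

lemma hasDeriv_phi (x : ℝ) :
    HasDerivAt (gaussianPDFReal 0 1) (-x * gaussianPDFReal 0 1 x) x := by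
  rw [phi_eq]
  have h1 : HasDerivAt (fun x : ℝ => -(x ^ 2) / 2) (-x) x := by
    have := ((hasDerivAt_pow 2 x).neg).div_const 2
    refine this.congr_deriv ?_
    simp; ring
  refine (h1.exp.const_mul (√(2 * π))⁻¹).congr_deriv ?_
  ring

lemma gauss_ibp (g g' : ℝ → ℝ) (A : ℝ) (hg : ∀ x, HasDerivAt g (g' x) x)
    (hg'c : Continuous g') (hA : ∀ x, |g x| ≤ A * (1 + x ^ 2))
    (hA' : ∀ x, |g' x| ≤ A * (1 + x ^ 2)) :
    ∫ x, (x ^ 2 - 1) * g x ∂gam = ∫ x, x * g' x ∂gam := by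
  have hgc : Continuous g := continuous_iff_continuousAt.2 fun x => (hg x).continuousAt
  have h0 := integrable_pow_gam
  have dom : ∀ F : ℝ → ℝ, Continuous F → (∀ x, |F x| ≤ A * (1 + x ^ 2) * (1 + x ^ 2)) →
      Integrable F gam := by
    intro F hF hb
    have : Integrable (fun x : ℝ => A * (1 + x ^ 2) * (1 + x ^ 2)) gam := by
      have : Integrable (fun x : ℝ => A * (x ^ 0 + 2 * x ^ 2 + x ^ 4)) gam :=
        (((h0 0).add ((h0 2).const_mul 2)).add (h0 4)).const_mul A
      refine this.congr ?_
      filter_upwards with x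
      ring
    refine this.mono' hF.aestronglyMeasurable ?_
    filter_upwards with x using hb x
  have hx : ∀ x : ℝ, |x| ≤ 1 + x ^ 2 := fun x => by
    rw [abs_le]; constructor <;> nlinarith [sq_nonneg (x + 1), sq_nonneg (x - 1)]
  have hx2 : ∀ x : ℝ, |x ^ 2 - 1| ≤ 1 + x ^ 2 := fun x => by
    rw [abs_le]; constructor <;> nlinarith [sq_nonneg (x + 1), sq_nonneg (x - 1)]
  have hb : ∀ (p q : ℝ) (x : ℝ), |p| ≤ 1 + x ^ 2 → |q| ≤ A * (1 + x ^ 2) →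
      |p * q| ≤ A * (1 + x ^ 2) * (1 + x ^ 2) := by
    intro p q x hp hq
    rw [abs_mul, mul_comm]
    exact mul_le_mul hq hp (abs_nonneg _) ((abs_nonneg _).trans hq)
  have i1 : Integrable (fun x => (x ^ 2 - 1) * g x) gam :=
    dom _ (by fun_prop) fun x => hb _ _ x (hx2 x) (hA x)
  have i2 : Integrable (fun x => x * g' x) gam :=
    dom _ (by fun_prop) fun x => hb _ _ x (hx x) (hA' x)
  have i3 : Integrable (fun x => x * g x) gam :=
    dom _ (by fun_prop) fun x => hb _ _ x (hx x) (hA x)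
  rw [integrable_gam_iff] at i1 i2 i3
  rw [integral_gam, integral_gam]
  have key := integral_mul_deriv_eq_deriv_mul_of_integrable (u := g) (u' := g')
    (v := fun x => -x * gaussianPDFReal 0 1 x)
    (v' := fun x => (x ^ 2 - 1) * gaussianPDFReal 0 1 x)
    (fun x _ => hg x) (fun x _ => by
      refine ((hasDerivAt_id x).neg.mul (hasDeriv_phi x)).congr_deriv ?_
      simp; ring)
    (i1.congr (by filter_upwards with x; simp; ring))
    (i2.neg.congr (by filter_upwards with x; simp; ring))
    (i3.neg.congr (by filter_upwards with x; simp; ring))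
  calc _ = ∫ x, g x * ((x ^ 2 - 1) * gaussianPDFReal 0 1 x) := by
        congr 1; ext x; ring
    _ = _ := key
    _ = _ := by
        rw [← integral_neg]; congr 1; ext x; ring

lemma phi_cont : Continuous (gaussianPDFReal 0 1) :=
  continuous_iff_continuousAt.2 fun x => (hasDeriv_phi x).continuousAt

lemma phi_pos (x : ℝ) : 0 < gaussianPDFReal 0 1 x := gaussianPDFReal_pos _ _ _ one_ne_zero

lemma phi_tendsto (l : Filter ℝ) (hl : Tendsto (fun x : ℝ => x ^ 2) l atTop) :
    Tendsto (gaussianPDFReal 0 1) l (nhds 0) := by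
  rw [phi_eq]
  rw [show (0 : ℝ) = (√(2 * π))⁻¹ * 0 by simp]
  refine Tendsto.const_mul _ (tendsto_exp_atBot.comp ?_)
  have : (fun x : ℝ => -(x ^ 2) / 2) = fun x => -(x ^ 2 / 2) := by ext x; ring
  rw [this]
  exact tendsto_neg_atTop_atBot.comp (hl.atTop_div_const (by norm_num))

lemma phi_xint : Integrable (fun x : ℝ => -x * gaussianPDFReal 0 1 x) := by
  have := (integrable_gam_iff _).1 (integrable_pow_gam 1)
  refine this.neg.congr ?_
  filter_upwards with x
  simp; ring

lemma mills_Iic (w : ℝ) :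
    ∫ x in Set.Iic w, -x * gaussianPDFReal 0 1 x = gaussianPDFReal 0 1 w := by
  have := integral_Iic_of_hasDerivAt_of_tendsto' (a := w) (m := 0) (f := gaussianPDFReal 0 1)
    (f' := fun x : ℝ => -x * gaussianPDFReal 0 1 x)
    (fun x _ => hasDeriv_phi x) phi_xint.integrableOn
    (phi_tendsto _ (by
      simpa [Function.comp_def] using (tendsto_pow_atTop (α := ℝ) two_ne_zero).comp
        tendsto_neg_atBot_atTop))
  simpa using this

lemma mills_Ioi (w : ℝ) :
    ∫ x in Set.Ioi w, x * gaussianPDFReal 0 1 x = gaussianPDFReal 0 1 w := by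
  have := integral_Ioi_of_hasDerivAt_of_tendsto' (a := w) (m := 0) (f := gaussianPDFReal 0 1)
    (f' := fun x : ℝ => -x * gaussianPDFReal 0 1 x)
    (fun x _ => hasDeriv_phi x) phi_xint.integrableOn
    (phi_tendsto _ (tendsto_pow_atTop (by norm_num)))
  have h2 : ∫ x in Set.Ioi w, x * gaussianPDFReal 0 1 x
      = -∫ x in Set.Ioi w, -x * gaussianPDFReal 0 1 x := by
    rw [← integral_neg]; congr 1; ext x; ring
  rw [h2, this]; ring

lemma stein_sol (h : ℝ → ℝ) (hc : Continuous h) (h01 : ∀ x, 0 ≤ h x ∧ h x ≤ 1) :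
    ∃ f f' : ℝ → ℝ, (∀ w, HasDerivAt f (f' w) w) ∧ Continuous f' ∧ (∀ w, |f' w| ≤ 2) ∧
      ∀ w, f' w - w * f w = h w - ∫ x, h x ∂gam := by
  set m := ∫ x, h x ∂gam with hm
  have hint : Integrable h gam := by
    refine (integrable_const (1 : ℝ)).mono' hc.aestronglyMeasurable ?_
    filter_upwards with x
    rw [Real.norm_eq_abs, abs_of_nonneg (h01 x).1]; exact (h01 x).2
  have hm0 : 0 ≤ m := integral_nonneg fun x => (h01 x).1
  have hm1 : m ≤ 1 := by
    have := integral_mono hint (integrable_const (1 : ℝ)) (fun x => (h01 x).2)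
    simpa using this
  set k : ℝ → ℝ := fun x => h x - m with hk
  have hkc : Continuous k := by fun_prop
  have hk1 : ∀ x, |k x| ≤ 1 := fun x => by
    rw [abs_le]; constructor <;> simp only [hk] <;> linarith [(h01 x).1, (h01 x).2]
  have hkint : Integrable k gam := hint.sub (integrable_const m)
  set p : ℝ → ℝ := gaussianPDFReal 0 1 with hp
  have hpc : Continuous p := phi_cont
  have hpp : ∀ x, 0 < p x := phi_pos
  have hpk : Integrable (fun x => p x * k x) := (integrable_gam_iff k).1 hkint
  have htot : ∫ x, p x * k x = 0 := by
    rw [← integral_gam, hk, integral_sub hint (integrable_const m)]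
    simp [hm]
  set F : ℝ → ℝ := fun w => ∫ x in Set.Iic w, p x * k x with hF
  have hFd : ∀ w, HasDerivAt F (p w * k w) w := by
    intro w
    have h1 : HasDerivAt (fun u => ∫ x in (0 : ℝ)..u, p x * k x) (p w * k w) w :=
      (hpc.mul hkc).integral_hasStrictDerivAt 0 w |>.hasDerivAt
    have h2 : F = fun u => F 0 + ∫ x in (0 : ℝ)..u, p x * k x := by
      ext u
      rw [← intervalIntegral.integral_Iic_sub_Iic hpk.integrableOn hpk.integrableOn]
      simp [hF]
    rw [h2]
    exact h1.const_add _
  have hFb : ∀ w, |w * F w| ≤ p w := by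
    intro w
    rcases le_total w 0 with hw | hw
    · calc |w * F w| = |∫ x in Set.Iic w, w * (p x * k x)| := by
            rw [integral_const_mul]
        _ ≤ ∫ x in Set.Iic w, |w * (p x * k x)| := abs_integral_le_integral_abs
        _ ≤ ∫ x in Set.Iic w, -x * p x := by
            refine setIntegral_mono_on (hpk.const_mul w).abs.integrableOn phi_xint.integrableOn
              measurableSet_Iic fun x hx => ?_
            rw [abs_mul, abs_mul, abs_of_nonpos hw, abs_of_pos (hpp x)]
            have hx : x ≤ w := hx
            calc -w * (p x * |k x|) ≤ -w * (p x * 1) := by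
                  gcongr
                  · linarith
                  · exact (hpp x).le
                  · exact hk1 x
              _ ≤ -x * p x := by
                  rw [mul_one]; gcongr
                  · exact (hpp x).le
        _ = p w := mills_Iic w
    · have hFw : F w = -∫ x in Set.Ioi w, p x * k x := by
        have := intervalIntegral.integral_Iic_add_Ioi (b := w) hpk.integrableOn hpk.integrableOn
        rw [htot] at this
        simp only [hF]; linarith
      calc |w * F w| = |∫ x in Set.Ioi w, w * (p x * k x)| := by
            rw [integral_const_mul, hFw, mul_neg, abs_neg]
        _ ≤ ∫ x in Set.Ioi w, |w * (p x * k x)| := abs_integral_le_integral_abs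
        _ ≤ ∫ x in Set.Ioi w, x * p x := by
            refine setIntegral_mono_on (hpk.const_mul w).abs.integrableOn
              ((phi_xint.neg.congr (by filter_upwards with x; simp [hp])).integrableOn)
              measurableSet_Ioi fun x hx => ?_
            rw [abs_mul, abs_mul, abs_of_nonneg hw, abs_of_pos (hpp x)]
            have hx : w < x := hx
            calc w * (p x * |k x|) ≤ w * (p x * 1) := by
                  gcongr
                  · exact (hpp x).le
                  · exact hk1 x
              _ ≤ x * p x := by
                  rw [mul_one]; gcongr
                  · exact (hpp x).le
        _ = p w := mills_Ioi w
  have hFc : Continuous F := continuous_iff_continuousAt.2 fun x => (hFd x).continuousAt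
  refine ⟨fun w => F w / p w, fun w => k w + w * (F w / p w), ?_, ?_, ?_, ?_⟩
  · intro w
    refine ((hFd w).div (hasDeriv_phi w) (hpp w).ne').congr_deriv ?_
    have := (hpp w).ne'
    rw [← hp]
    field_simp
    ring
  · have : ∀ x, p x ≠ 0 := fun x => (hpp x).ne'
    fun_prop (disch := assumption)
  · intro w
    calc |k w + w * (F w / p w)| ≤ |k w| + |w * (F w / p w)| := abs_add_le _ _
      _ ≤ 1 + 1 := by
          refine add_le_add (hk1 w) ?_
          rw [← mul_div_assoc, abs_div, abs_of_pos (hpp w), div_le_one (hpp w)]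
          exact hFb w
      _ = 2 := by norm_num
  · intro w; simp only [hk]; ring

abbrev stdn (n : ℕ) : Measure (Fin n → ℝ) := Measure.pi fun _ => gam

def Wb {n : ℕ} (b : Fin n → ℝ) (x : Fin n → ℝ) : ℝ := ∑ i, b i * ((x i) ^ 2 - 1)

lemma Wb_cont {n : ℕ} (b : Fin n → ℝ) : Continuous (Wb b) := by
  unfold Wb; fun_prop

lemma memLp_sq {n : ℕ} (i : Fin n) : MemLp (fun x : Fin n → ℝ => (x i) ^ 2) 2 (stdn n) := by
  have h : MemLp (fun x : ℝ => x ^ 2) 2 gam := by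
    rw [memLp_two_iff_integrable_sq (by fun_prop)]
    simpa [← pow_mul] using integrable_pow_gam 4
  exact h.comp_measurePreserving (measurePreserving_eval (fun _ : Fin n => gam) i)

lemma memLp_sq1 {n : ℕ} (i : Fin n) :
    MemLp (fun x : Fin n → ℝ => (x i) ^ 2 - 1) 2 (stdn n) :=
  (memLp_sq i).sub (memLp_const 1)

lemma memLp_Wb {n : ℕ} (b : Fin n → ℝ) : MemLp (Wb b) 2 (stdn n) := by
  have : Wb b = fun x => ∑ i, b i * ((x i) ^ 2 - 1) := rfl
  rw [this]
  exact memLp_finsetSum _ fun i _ => (memLp_sq1 i).const_mul (b i)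

lemma lin_growth (f f' : ℝ → ℝ) (K : ℝ) (hf : ∀ w, HasDerivAt f (f' w) w)
    (hK : ∀ w, |f' w| ≤ K) (w : ℝ) : |f w| ≤ |f 0| + K * |w| := by
  have := Convex.norm_image_sub_le_of_norm_hasDerivWithin_le (f := f) (f' := f') (C := K)
    (s := Set.univ) (x := 0) (y := w) (fun x _ => (hf x).hasDerivWithinAt) (fun x _ => hK x)
    convex_univ trivial trivial
  simp only [Real.norm_eq_abs, sub_zero] at this
  calc |f w| = |f 0 + (f w - f 0)| := by ring_nf
    _ ≤ _ := (abs_add_le _ _).trans (by gcongr)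

lemma memLp_fW {n : ℕ} (b : Fin n → ℝ) (f f' : ℝ → ℝ) (K : ℝ)
    (hf : ∀ w, HasDerivAt f (f' w) w) (hK : ∀ w, |f' w| ≤ K) :
    MemLp (fun x => f (Wb b x)) 2 (stdn n) := by
  have hfc : Continuous f := continuous_iff_continuousAt.2 fun x => (hf x).continuousAt
  have h1 : MemLp (fun x => |f 0| + K * |Wb b x|) 2 (stdn n) :=
    (memLp_const |f 0|).add (((memLp_Wb b).norm).const_mul K)
  refine h1.mono (hfc.comp (Wb_cont b)).aestronglyMeasurable ?_
  filter_upwards with x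
  exact (lin_growth f f' K hf hK _).trans (le_abs_self _)

lemma stein_coord {n : ℕ} (b : Fin n → ℝ) (f f' : ℝ → ℝ) (K : ℝ)
    (hf : ∀ w, HasDerivAt f (f' w) w) (hf'c : Continuous f') (hK : ∀ w, |f' w| ≤ K) (i : Fin n) :
    ∫ x, ((x i) ^ 2 - 1) * f (Wb b x) ∂(stdn n)
      = ∫ x, 2 * b i * (x i) ^ 2 * f' (Wb b x) ∂(stdn n) := by
  have hfc : Continuous f := continuous_iff_continuousAt.2 fun x => (hf x).continuousAt
  have I1 : Integrable (fun x => ((x i) ^ 2 - 1) * f (Wb b x)) (stdn n) :=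
    (memLp_sq1 i).integrable_mul (memLp_fW b f f' K hf hK)
  have I2 : Integrable (fun x => 2 * b i * (x i) ^ 2 * f' (Wb b x)) (stdn n) := by
    refine Integrable.mul_bdd (c := K) (((memLp_sq i).integrable one_le_two).const_mul _)
      (hf'c.comp (Wb_cont b)).aestronglyMeasurable ?_
    filter_upwards with x using hK _
  obtain ⟨m, rfl⟩ : ∃ m, n = m + 1 := ⟨n - 1, by have := i.2; omega⟩
  have mp := (measurePreserving_piFinSuccAbove (fun _ : Fin (m + 1) => gam) i).symm
  have hW : ∀ (x : ℝ) (y : Fin m → ℝ), Wb b (i.insertNth x y)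
      = b i * (x ^ 2 - 1) + ∑ j, b (i.succAbove j) * ((y j) ^ 2 - 1) := by
    intro x y
    simp [Wb, Fin.sum_univ_succAbove _ i]
  have hW' : ∀ (x : ℝ) (y : Fin m → ℝ), Wb b ((Fin.insertNthEquiv (fun _ => ℝ) i) (x, y))
      = b i * (x ^ 2 - 1) + ∑ j, b (i.succAbove j) * ((y j) ^ 2 - 1) := hW
  rw [← mp.integral_comp', ← mp.integral_comp']
  have J1 := (mp.integrable_comp_emb (MeasurableEquiv.measurableEmbedding _)).2 I1
  have J2 := (mp.integrable_comp_emb (MeasurableEquiv.measurableEmbedding _)).2 I2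
  simp only [Function.comp_def] at J1 J2
  rw [integral_prod_symm _ J1, integral_prod_symm _ J2]
  congr 1
  ext y
  simp only [MeasurableEquiv.piFinSuccAbove_symm_apply, Fin.insertNthEquiv_apply,
    Fin.insertNth_apply_same, hW']
  set r := ∑ j, b (i.succAbove j) * ((y j) ^ 2 - 1) with hr
  have hK0 : 0 ≤ K := (abs_nonneg _).trans (hK 0)
  have := gauss_ibp (fun x => f (b i * (x ^ 2 - 1) + r))
    (fun x => f' (b i * (x ^ 2 - 1) + r) * (b i * (2 * x)))
    (|f 0| + K * (2 * |b i| + |r|)) ?_ ?_ ?_ ?_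
  · rw [this]
    congr 1; ext x; ring
  · intro x
    have h1 : HasDerivAt (fun x : ℝ => b i * (x ^ 2 - 1) + r) (b i * (2 * x)) x := by
      refine ((((hasDerivAt_pow 2 x).sub_const 1).const_mul (b i)).add_const r).congr_deriv ?_
      simp
    exact (hf _).comp x h1
  · fun_prop
  · intro x
    refine (lin_growth f f' K hf hK _).trans ?_
    have h2 : |b i * (x ^ 2 - 1) + r| ≤ |b i| * (1 + x ^ 2) + |r| := by
      refine (abs_add_le _ _).trans ?_
      rw [abs_mul]
      gcongr
      rw [abs_le]; constructor <;> nlinarith [sq_nonneg x]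
    have h3 : K * |b i * (x ^ 2 - 1) + r| ≤ K * (|b i| * (1 + x ^ 2) + |r|) := by gcongr
    have h4 : 0 ≤ |f 0| * x ^ 2 := by positivity
    have h5 : 0 ≤ K * |b i| * (1 + x ^ 2) := by positivity
    have h6 : 0 ≤ K * |r| * x ^ 2 := by positivity
    nlinarith
  · intro x
    rw [abs_mul, abs_mul, abs_mul, abs_two]
    have hx : 2 * |x| ≤ 1 + x ^ 2 := by
      rw [← sq_abs x]; nlinarith [sq_nonneg (|x| - 1)]
    calc |f' (b i * (x ^ 2 - 1) + r)| * (|b i| * (2 * |x|)) ≤ K * (|b i| * (1 + x ^ 2)) := by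
          gcongr; exact hK _
      _ ≤ (|f 0| + K * (2 * |b i| + |r|)) * (1 + x ^ 2) := by
          have h4 : 0 ≤ |f 0| * (1 + x ^ 2) := by positivity
          have h5 : 0 ≤ K * |b i| * (1 + x ^ 2) := by positivity
          have h6 : 0 ≤ K * |r| * (1 + x ^ 2) := by positivity
          nlinarith

lemma stein_id {n : ℕ} (b : Fin n → ℝ) (f f' : ℝ → ℝ) (K : ℝ)
    (hf : ∀ w, HasDerivAt f (f' w) w) (hf'c : Continuous f') (hK : ∀ w, |f' w| ≤ K) :
    ∫ x, Wb b x * f (Wb b x) ∂(stdn n)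
      = ∫ x, (∑ i, 2 * b i ^ 2 * (x i) ^ 2) * f' (Wb b x) ∂(stdn n) := by
  have I1 : ∀ i, Integrable (fun x => b i * (((x i) ^ 2 - 1) * f (Wb b x))) (stdn n) :=
    fun i => ((memLp_sq1 i).integrable_mul (memLp_fW b f f' K hf hK)).const_mul _
  have I2 : ∀ i, Integrable (fun x => b i * (2 * b i * (x i) ^ 2 * f' (Wb b x))) (stdn n) := by
    intro i
    refine (Integrable.mul_bdd (c := K) (((memLp_sq i).integrable one_le_two).const_mul _)
      (hf'c.comp (Wb_cont b)).aestronglyMeasurable ?_).const_mul _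
    filter_upwards with x using hK _
  calc ∫ x, Wb b x * f (Wb b x) ∂(stdn n)
      = ∫ x, ∑ i, b i * (((x i) ^ 2 - 1) * f (Wb b x)) ∂(stdn n) := by
        congr 1; ext x
        have hh : Wb b x = ∑ i, b i * ((x i) ^ 2 - 1) := rfl
        generalize f (Wb b x) = q
        rw [hh, Finset.sum_mul]
        exact Finset.sum_congr rfl fun i _ => by ring
    _ = ∑ i, ∫ x, b i * (((x i) ^ 2 - 1) * f (Wb b x)) ∂(stdn n) :=
        integral_finsetSum _ fun i _ => I1 i
    _ = ∑ i, ∫ x, b i * (2 * b i * (x i) ^ 2 * f' (Wb b x)) ∂(stdn n) := by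
        refine Finset.sum_congr rfl fun i _ => ?_
        rw [integral_const_mul, integral_const_mul, stein_coord b f f' K hf hf'c hK i]
    _ = ∫ x, ∑ i, b i * (2 * b i * (x i) ^ 2 * f' (Wb b x)) ∂(stdn n) :=
        (integral_finsetSum _ fun i _ => I2 i).symm
    _ = _ := by
        congr 1; ext x
        rw [Finset.sum_mul]
        exact Finset.sum_congr rfl fun i _ => by ring

lemma integral_sq_gam : ∫ x : ℝ, x ^ 2 ∂gam = 1 := by
  have := gauss_ibp (fun _ => 1) (fun _ => 0) 1 (fun x => hasDerivAt_const x 1) continuous_const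
    (fun x => by simp; positivity) (fun x => by simp; positivity)
  simp only [mul_one, mul_zero, integral_zero] at this
  rw [integral_sub (integrable_pow_gam 2) (integrable_const 1)] at this
  simp at this; linarith

lemma integral_sq_coord {n : ℕ} (i : Fin n) : ∫ x, (x i) ^ 2 ∂(stdn n) = 1 := by
  have := (measurePreserving_eval (fun _ : Fin n => gam) i).map_eq
  rw [← integral_sq_gam, ← this, integral_map (measurable_pi_apply i).aemeasurable (by fun_prop)]

lemma Wb_second {n : ℕ} (b : Fin n → ℝ) :
    ∫ x, Wb b x ^ 2 ∂(stdn n) = 2 * ∑ i, b i ^ 2 := by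
  have := stein_id b (fun w => w) (fun _ => 1) 1 (fun w => hasDerivAt_id w) continuous_const
    (by simp)
  simp only [mul_one] at this
  simp only [pow_two (Wb b _)]
  rw [this, integral_finsetSum _ fun i _ => ((memLp_sq i).integrable one_le_two).const_mul _,
    Finset.mul_sum]
  refine Finset.sum_congr rfl fun i _ => ?_
  rw [integral_const_mul, integral_sq_coord, mul_one]

lemma berry_smooth {n : ℕ} (b : Fin n → ℝ) (δ : ℝ) (hδ : 0 < δ) (hb : ∀ i, |b i| ≤ δ)
    (hb1 : 2 * ∑ i, b i ^ 2 = 1) (h : ℝ → ℝ) (hc : Continuous h)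
    (h01 : ∀ x, 0 ≤ h x ∧ h x ≤ 1) :
    |∫ x, h (Wb b x) ∂(stdn n) - ∫ x, h x ∂gam| ≤ 4 * δ := by
  obtain ⟨f, f', hf, hf'c, hK, hst⟩ := stein_sol h hc h01
  have hfc : Continuous f := continuous_iff_continuousAt.2 fun x => (hf x).continuousAt
  have If' : Integrable (fun x => f' (Wb b x)) (stdn n) := by
    refine (integrable_const (2 : ℝ)).mono' (hf'c.comp (Wb_cont b)).aestronglyMeasurable ?_
    filter_upwards with x using hK _
  have IWf : Integrable (fun x => Wb b x * f (Wb b x)) (stdn n) :=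
    (memLp_Wb b).integrable_mul (memLp_fW b f f' 2 hf hK)
  have Iτ : Integrable (fun x : Fin n → ℝ => ∑ i, 2 * b i ^ 2 * (x i) ^ 2) (stdn n) :=
    integrable_finsetSum _ fun i _ => ((memLp_sq i).integrable one_le_two).const_mul _
  have Iτf : Integrable (fun x => (∑ i, 2 * b i ^ 2 * (x i) ^ 2) * f' (Wb b x)) (stdn n) := by
    refine Integrable.mul_bdd (c := 2) Iτ (hf'c.comp (Wb_cont b)).aestronglyMeasurable ?_
    filter_upwards with x using hK _
  have Ih : Integrable (fun x => h (Wb b x)) (stdn n) := by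
    refine (integrable_const (1 : ℝ)).mono' (hc.comp (Wb_cont b)).aestronglyMeasurable ?_
    filter_upwards with x
    rw [Real.norm_eq_abs, abs_of_nonneg (h01 _).1]; exact (h01 _).2
  have e1 : ∫ x, h (Wb b x) ∂(stdn n) - ∫ x, h x ∂gam
      = ∫ x, f' (Wb b x) * (1 - ∑ i, 2 * b i ^ 2 * (x i) ^ 2) ∂(stdn n) := by
    have s1 : ∫ x, (h (Wb b x) - ∫ y, h y ∂gam) ∂(stdn n)
        = ∫ x, (f' (Wb b x) - Wb b x * f (Wb b x)) ∂(stdn n) := by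
      congr 1; ext x; rw [hst]
    rw [integral_sub Ih (integrable_const _), integral_sub If' IWf,
      stein_id b f f' 2 hf hf'c hK, ← integral_sub If' Iτf] at s1
    simp only [integral_const, probReal_univ, one_smul] at s1
    rw [s1]
    congr 1; ext x; ring
  have hτ : ∀ x : Fin n → ℝ, 1 - ∑ i, 2 * b i ^ 2 * (x i) ^ 2
      = - Wb (fun i => 2 * b i ^ 2) x := by
    intro x
    rw [← hb1, Finset.mul_sum, ← Finset.sum_sub_distrib, Wb, ← Finset.sum_neg_distrib]
    exact Finset.sum_congr rfl fun i _ => by ring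
  have h2 := Wb_second (fun i => 2 * b i ^ 2)
  have h3 : 2 * ∑ i, (2 * b i ^ 2) ^ 2 ≤ 4 * δ ^ 2 := by
    calc 2 * ∑ i, (2 * b i ^ 2) ^ 2 ≤ 2 * ∑ i, (4 * δ ^ 2 * b i ^ 2) := by
          gcongr with i
          have : b i ^ 2 ≤ δ ^ 2 := by rw [← sq_abs]; gcongr; exact hb i
          nlinarith [sq_nonneg (b i)]
      _ = 4 * δ ^ 2 * (2 * ∑ i, b i ^ 2) := by rw [← Finset.mul_sum]; ring
      _ = 4 * δ ^ 2 := by rw [hb1, mul_one]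
  have Isq : Integrable (fun x => Wb (fun i => 2 * b i ^ 2) x ^ 2) (stdn n) :=
    (memLp_Wb _).integrable_sq
  rw [e1]
  calc |∫ x, f' (Wb b x) * (1 - ∑ i, 2 * b i ^ 2 * (x i) ^ 2) ∂(stdn n)|
      ≤ ∫ x, |f' (Wb b x) * (1 - ∑ i, 2 * b i ^ 2 * (x i) ^ 2)| ∂(stdn n) :=
        abs_integral_le_integral_abs
    _ ≤ ∫ x, (Wb (fun i => 2 * b i ^ 2) x ^ 2 * (1 / (2 * δ)) + 2 * δ) ∂(stdn n) := by
        refine integral_mono_of_nonneg (by filter_upwards with x using abs_nonneg _)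
          ((Isq.mul_const _).add (integrable_const _)) ?_
        filter_upwards with x
        rw [hτ, abs_mul, abs_neg]
        set y := |Wb (fun i => 2 * b i ^ 2) x|
        rw [← sq_abs (Wb (fun i => 2 * b i ^ 2) x)]
        have hy : 0 ≤ y := abs_nonneg _
        calc |f' (Wb b x)| * y ≤ 2 * y := by gcongr; exact hK _
          _ ≤ y ^ 2 * (1 / (2 * δ)) + 2 * δ := by
            have : y ^ 2 * (1 / (2 * δ)) + 2 * δ - 2 * y = (y - 2 * δ) ^ 2 / (2 * δ) := by
              field_simp; ring
            have : 0 ≤ (y - 2 * δ) ^ 2 / (2 * δ) := by positivity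
            linarith
    _ = (2 * ∑ i, (2 * b i ^ 2) ^ 2) * (1 / (2 * δ)) + 2 * δ := by
        rw [integral_add (Isq.mul_const _) (integrable_const _), integral_mul_const, h2]
        simp
    _ ≤ 4 * δ ^ 2 * (1 / (2 * δ)) + 2 * δ := by gcongr
    _ = 4 * δ := by field_simp; ring

lemma gaussQ_eq (t : ℝ) : GM.gaussQ t = ∫ s in Set.Ioi t, gaussianPDFReal 0 1 s := by
  rw [phi_eq]; rfl

lemma gaussQ_sub (t s : ℝ) : GM.gaussQ t - GM.gaussQ s = ∫ x in t..s, gaussianPDFReal 0 1 x := by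
  rw [gaussQ_eq, gaussQ_eq]
  exact intervalIntegral.integral_Ioi_sub_Ioi' (integrable_gaussianPDFReal 0 1).integrableOn
    (integrable_gaussianPDFReal 0 1).integrableOn

lemma phi_le_one (x : ℝ) : gaussianPDFReal 0 1 x ≤ 1 := by
  rw [phi_eq]
  have h1 : (1 : ℝ) ≤ √(2 * π) := by
    rw [Real.one_le_sqrt]; nlinarith [Real.pi_gt_three]
  have h2 : rexp (-(x ^ 2) / 2) ≤ 1 := by
    rw [Real.exp_le_one_iff]; nlinarith [sq_nonneg x]
  have h3 := inv_le_one_of_one_le₀ h1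
  calc (√(2 * π))⁻¹ * rexp (-(x ^ 2) / 2) ≤ 1 * 1 := by gcongr
    _ = 1 := one_mul 1

lemma gaussQ_lip (t s : ℝ) (hts : t ≤ s) : GM.gaussQ t - GM.gaussQ s ≤ s - t := by
  rw [gaussQ_sub]
  have := intervalIntegral.integral_mono_on (μ := volume) hts (phi_cont.intervalIntegrable t s)
    (continuous_const.intervalIntegrable t s) (fun x _ => phi_le_one x)
  simpa using this

lemma gaussQ_anti (t s : ℝ) (hts : t ≤ s) : GM.gaussQ s ≤ GM.gaussQ t := by
  have := gaussQ_sub t s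
  have h2 : 0 ≤ ∫ x in t..s, gaussianPDFReal 0 1 x :=
    intervalIntegral.integral_nonneg hts fun x _ => (phi_pos x).le
  linarith

lemma gaussQ_lower (q : ℝ) : ∃ κ : ℝ, 0 < κ ∧ ∀ δ, 0 ≤ δ → δ ≤ 1 →
    GM.gaussQ q + κ * δ ≤ GM.gaussQ (q - δ) := by
  refine ⟨gaussianPDFReal 0 1 (|q| + 1), phi_pos _, fun δ h0 h1 => ?_⟩
  have := gaussQ_sub (q - δ) q
  have h2 := intervalIntegral.integral_mono_on (μ := volume) (a := q - δ) (b := q) (by linarith)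
    (continuous_const.intervalIntegrable _ _) (phi_cont.intervalIntegrable _ _)
    (f := fun _ => gaussianPDFReal 0 1 (|q| + 1)) (fun x hx => by
      rw [phi_eq]
      have : |x| ≤ |q| + 1 := by
        rw [abs_le]
        constructor <;> linarith [hx.1, hx.2, neg_abs_le q, le_abs_self q]
      have h3 : x ^ 2 ≤ (|q| + 1) ^ 2 := by rw [← sq_abs x]; gcongr
      dsimp only
      gcongr)
  simp at h2
  linarith

lemma gaussQ_gam (t : ℝ) : GM.gaussQ t = gam.real (Set.Ioi t) := by
  rw [gaussQ_eq, measureReal_def, gam, gaussianReal_apply_eq_integral 0 one_ne_zero,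
    ENNReal.toReal_ofReal]
  exact setIntegral_nonneg measurableSet_Ioi fun x _ => (phi_pos x).le

lemma berry_tail {n : ℕ} (b : Fin n → ℝ) (δ : ℝ) (hδ : 0 < δ) (hb : ∀ i, |b i| ≤ δ)
    (hb1 : 2 * ∑ i, b i ^ 2 = 1) (z : ℝ) :
    GM.gaussQ z - 5 * δ ≤ (stdn n).real {x | z ≤ Wb b x} := by
  set h : ℝ → ℝ := fun x => max 0 (min 1 ((x - z) / δ)) with hh
  have hc : Continuous h := by fun_prop
  have h01 : ∀ x, 0 ≤ h x ∧ h x ≤ 1 := fun x => by simp [hh]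
  have key := (abs_le.1 (berry_smooth b δ hδ hb hb1 h hc h01)).1
  have Ig : Integrable h gam := by
    refine (integrable_const (1 : ℝ)).mono' hc.aestronglyMeasurable ?_
    filter_upwards with x
    rw [Real.norm_eq_abs, abs_of_nonneg (h01 x).1]; exact (h01 x).2
  have Ih : Integrable (fun x => h (Wb b x)) (stdn n) := by
    refine (integrable_const (1 : ℝ)).mono' (hc.comp (Wb_cont b)).aestronglyMeasurable ?_
    filter_upwards with x
    rw [Real.norm_eq_abs, abs_of_nonneg (h01 _).1]; exact (h01 _).2
  have hms : MeasurableSet {x | z ≤ Wb b x} :=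
    measurableSet_le measurable_const (Wb_cont b).measurable
  have up : ∫ x, h (Wb b x) ∂(stdn n) ≤ (stdn n).real {x | z ≤ Wb b x} := by
    rw [← integral_indicator_one hms]
    refine integral_mono Ih ((integrable_const (1 : ℝ)).indicator hms) fun x => ?_
    by_cases hx : z ≤ Wb b x
    · rw [Set.indicator_of_mem (by exact hx)]; exact (h01 _).2
    · rw [Set.indicator_of_notMem (by exact hx)]
      simp only [hh]
      rw [max_eq_left]
      refine (min_le_right _ _).trans (div_nonpos_of_nonpos_of_nonneg ?_ hδ.le)
      push Not at hx; linarith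
  have lo : GM.gaussQ (z + δ) ≤ ∫ x, h x ∂gam := by
    rw [gaussQ_gam, ← integral_indicator_one measurableSet_Ioi]
    refine integral_mono ((integrable_const (1 : ℝ)).indicator measurableSet_Ioi) Ig fun x => ?_
    by_cases hx : x ∈ Set.Ioi (z + δ)
    · rw [Set.indicator_of_mem hx]
      have : 1 ≤ (x - z) / δ := by
        rw [le_div_iff₀ hδ]; linarith [Set.mem_Ioi.1 hx]
      simp [hh, this]
    · rw [Set.indicator_of_notMem hx]; exact (h01 x).1
  have := gaussQ_lip z (z + δ) (by linarith)
  linarith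

def cc (θ s : ℝ) : ℝ := min θ s / (2 * θ)
def ll (θ s : ℝ) : ℝ := 1 / 2 * Real.log (max θ s / θ)

lemma conv_one (θ s v : ℝ) (hθ : 0 < θ) (hs : 0 < s) :
    Integrable (fun w => rexp (cc θ s * (w ^ 2 - 1) + ll θ s - (√s * w - v) ^ 2 / (2 * θ))) gam ∧
    ∫ w, rexp (cc θ s * (w ^ 2 - 1) + ll θ s - (√s * w - v) ^ 2 / (2 * θ)) ∂gam
      ≤ rexp (-cc θ s) := by
  have hss : √s ^ 2 = s := Real.sq_sqrt hs.le
  have hsp : 0 < √s := Real.sqrt_pos.2 hs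
  rcases le_total θ s with h | h
  · have hc : cc θ s = 1 / 2 := by rw [cc, min_eq_left h]; field_simp
    have hl : rexp (ll θ s) = √(s / θ) := by
      rw [ll, max_eq_right h, Real.sqrt_eq_rpow, Real.rpow_def_of_pos (by positivity)]
      ring_nf
    have e : ∀ w : ℝ, gaussianPDFReal 0 1 w *
        rexp (cc θ s * (w ^ 2 - 1) + ll θ s - (√s * w - v) ^ 2 / (2 * θ))
        = (√(2 * π))⁻¹ * √(s / θ) * rexp (-(1 / 2)) *
          rexp (-(s / (2 * θ)) * (w - v / √s) ^ 2) := by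
      intro w
      rw [phi_eq, ← hl, hc]
      dsimp only
      rw [mul_assoc, mul_assoc, mul_assoc, ← Real.exp_add, ← Real.exp_add, ← Real.exp_add]
      congr 2
      have : (√s * w - v) ^ 2 = s * (w - v / √s) ^ 2 := by
        rw [← hss]
        simp only [Real.sqrt_sq hsp.le]
        field_simp
      rw [this]; ring
    have hb : 0 < s / (2 * θ) := by positivity
    rw [integrable_gam_iff, integral_gam]
    simp only [e]
    constructor
    · exact (((integrable_exp_neg_mul_sq hb).comp_sub_right (v / √s))).const_mul _
    · rw [integral_const_mul,
        integral_sub_right_eq_self (fun w => rexp (-(s / (2 * θ)) * w ^ 2)) (v / √s),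
        integral_gaussian, hc]
      have : √(π / (s / (2 * θ))) = √(2 * π) * (√(s / θ))⁻¹ := by
        rw [← Real.sqrt_inv, ← Real.sqrt_mul (by positivity)]
        congr 1
        field_simp
      rw [this]
      have h1 : √(2 * π) ≠ 0 := by positivity
      have h2 : √(s / θ) ≠ 0 := by positivity
      apply le_of_eq
      field_simp
  · have hc : cc θ s = s / (2 * θ) := by rw [cc, min_eq_right h]
    have hl : ll θ s = 0 := by rw [ll, max_eq_left h]; simp [hθ.ne']
    have e : ∀ w : ℝ, rexp (cc θ s * (w ^ 2 - 1) + ll θ s - (√s * w - v) ^ 2 / (2 * θ))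
        = rexp (-cc θ s - v ^ 2 / (2 * θ)) * rexp (√s * v / θ * w) := by
      intro w
      rw [← Real.exp_add, hl, hc]
      congr 1
      have : (√s * w - v) ^ 2 = s * w ^ 2 - 2 * √s * w * v + v ^ 2 := by
        rw [← hss]; simp only [Real.sqrt_sq hsp.le]; ring
      rw [this]; field_simp; ring
    simp only [e]
    constructor
    · exact (integrable_exp_mul_gaussianReal _).const_mul _
    · rw [integral_const_mul]
      have := congrFun (mgf_fun_id_gaussianReal (μ := 0) (v := 1)) (√s * v / θ)
      simp only [mgf] at this
      rw [gam, this, ← Real.exp_add]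
      gcongr
      have h3 : (√s * v / θ) ^ 2 / 2 ≤ v ^ 2 / (2 * θ) := by
        rw [div_pow, mul_pow, hss]
        have : v ^ 2 / (2 * θ) - s * v ^ 2 / θ ^ 2 / 2 = v ^ 2 * (θ - s) / (2 * θ ^ 2) := by
          field_simp
        have : 0 ≤ v ^ 2 * (θ - s) / (2 * θ ^ 2) := by
          have : 0 ≤ θ - s := by linarith
          positivity
        linarith
      simp
      linarith

lemma conv_ball {n : ℕ} (θ D L : ℝ) (s v : Fin n → ℝ) (hθ : 0 < θ) (hs : ∀ i, 0 < s i) :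
    (stdn n).real ({w | ∑ i, (√(s i) * w i - v i) ^ 2 ≤ D} ∩
        {w | L ≤ Wb (fun i => cc θ (s i)) w + ∑ i, ll θ (s i)})
      ≤ rexp (D / (2 * θ) - ∑ i, cc θ (s i) - L) := by
  set G : (i : Fin n) → ℝ → ℝ := fun i w =>
    rexp (cc θ (s i) * (w ^ 2 - 1) + ll θ (s i) - (√(s i) * w - v i) ^ 2 / (2 * θ)) with hG
  have IG : Integrable (fun w : Fin n → ℝ => ∏ i, G i (w i)) (stdn n) :=
    Integrable.fintype_prod fun i => (conv_one θ (s i) (v i) hθ (hs i)).1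
  have bG : ∫ w : Fin n → ℝ, ∏ i, G i (w i) ∂(stdn n) ≤ rexp (-∑ i, cc θ (s i)) := by
    rw [integral_fintype_prod_eq_prod, ← Finset.sum_neg_distrib, Real.exp_sum]
    exact Finset.prod_le_prod (fun i _ => integral_nonneg fun w => (Real.exp_pos _).le)
      fun i _ => (conv_one θ (s i) (v i) hθ (hs i)).2
  have hms : MeasurableSet ({w : Fin n → ℝ | ∑ i, (√(s i) * w i - v i) ^ 2 ≤ D} ∩
        {w | L ≤ Wb (fun i => cc θ (s i)) w + ∑ i, ll θ (s i)}) := by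
    refine (measurableSet_le (by fun_prop) measurable_const).inter
      (measurableSet_le measurable_const ?_)
    exact ((Wb_cont _).measurable.add_const _)
  rw [← integral_indicator_one hms]
  calc _ ≤ ∫ w : Fin n → ℝ, rexp (D / (2 * θ) - L) * ∏ i, G i (w i) ∂(stdn n) := by
        refine integral_mono ((integrable_const (1 : ℝ)).indicator hms) (IG.const_mul _)
          fun w => ?_
        have hpos : 0 ≤ rexp (D / (2 * θ) - L) * ∏ i, G i (w i) :=
          mul_nonneg (Real.exp_pos _).le (Finset.prod_nonneg fun i _ => (Real.exp_pos _).le)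
        refine Set.indicator_apply_le' (fun hx => ?_) (fun _ => hpos)
        · simp only [hG]
          rw [← Real.exp_sum, ← Real.exp_add, Finset.sum_sub_distrib, Finset.sum_add_distrib,
            ← Finset.sum_div]
          obtain ⟨h1, h2⟩ := hx
          simp only [Set.mem_ofPred_eq, Wb] at h1 h2
          have h3 : (∑ i, (√(s i) * w i - v i) ^ 2) / (2 * θ) ≤ D / (2 * θ) := by gcongr
          simp only [Pi.one_apply]
          apply Real.one_le_exp
          linarith
    _ ≤ rexp (D / (2 * θ) - L) * rexp (-∑ i, cc θ (s i)) := by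
        rw [integral_const_mul]; gcongr
    _ = _ := by rw [← Real.exp_add]; ring_nf

lemma converse_coord {n M : ℕ} (θ D L : ℝ) (s : Fin n → ℝ) (v : Fin M → Fin n → ℝ)
    (hθ : 0 < θ) (hs : ∀ i, 0 < s i) :
    (stdn n).real {w | ∃ m, ∑ i, (√(s i) * w i - v m i) ^ 2 ≤ D}
      ≤ (stdn n).real {w | L ≤ Wb (fun i => cc θ (s i)) w + ∑ i, ll θ (s i)}ᶜ
        + M * rexp (D / (2 * θ) - ∑ i, cc θ (s i) - L) := by
  set J := {w : Fin n → ℝ | L ≤ Wb (fun i => cc θ (s i)) w + ∑ i, ll θ (s i)}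
  have sub : {w : Fin n → ℝ | ∃ m, ∑ i, (√(s i) * w i - v m i) ^ 2 ≤ D} ⊆
      Jᶜ ∪ ⋃ m, ({w : Fin n → ℝ | ∑ i, (√(s i) * w i - v m i) ^ 2 ≤ D} ∩ J) := by
    rintro w ⟨m, hm⟩
    by_cases h : w ∈ J
    · exact Or.inr (Set.mem_iUnion.2 ⟨m, hm, h⟩)
    · exact Or.inl h
  calc _ ≤ (stdn n).real (Jᶜ ∪ ⋃ m, ({w : Fin n → ℝ | ∑ i, (√(s i) * w i - v m i) ^ 2 ≤ D} ∩ J)) :=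
        measureReal_mono sub
    _ ≤ (stdn n).real Jᶜ + (stdn n).real
        (⋃ m, ({w : Fin n → ℝ | ∑ i, (√(s i) * w i - v m i) ^ 2 ≤ D} ∩ J)) :=
        measureReal_union_le _ _
    _ ≤ (stdn n).real Jᶜ + ∑ m : Fin M, rexp (D / (2 * θ) - ∑ i, cc θ (s i) - L) := by
        gcongr
        refine (measureReal_iUnion_fintype_le _).trans ?_
        gcongr with m
        exact conv_ball θ D L s (v m) hθ hs
    _ = _ := by simp

lemma fin_sum_succ {n : ℕ} (i : ℕ) (g : ℕ → ℝ) :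
    ∑ j : Fin n, (if i + 1 = (j : ℕ) then g j else 0) = if i + 1 < n then g (i + 1) else 0 := by
  rw [Fin.sum_univ_eq_sum_range (fun j => if i + 1 = j then g j else 0) n]
  simp

lemma fin_sum_pred {n : ℕ} (i : ℕ) (hi : i < n) (g : ℕ → ℝ) :
    ∑ j : Fin n, (if (j : ℕ) + 1 = i then g j else 0) = if 0 < i then g (i - 1) else 0 := by
  rw [Fin.sum_univ_eq_sum_range (fun j => if j + 1 = i then g j else 0) n]
  rcases i with _ | i
  · simp
  · have : i < n := by omega
    simp [this]

def Nm (n : ℕ) : Matrix (Fin n) (Fin n) ℝ :=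
  Matrix.of fun i j => if (j : ℕ) + 1 = (i : ℕ) then 1 else 0

def Em (a : ℝ) (n : ℕ) : Matrix (Fin n) (Fin n) ℝ :=
  Matrix.of fun i j => if j ≤ i then a ^ ((i : ℕ) - (j : ℕ)) else 0

def el (n : ℕ) : Fin n → ℝ := fun i => if (i : ℕ) + 1 = n then 1 else 0

lemma evolve_eq (a : ℝ) (n : ℕ) (z : Fin n → ℝ) : GM.evolve a n z = Em a n *ᵥ z := by
  ext i
  simp only [GM.evolve, Em, Matrix.mulVec, dotProduct, Matrix.of_apply, ite_mul, zero_mul]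
  rw [← Finset.sum_filter]
  congr 1
  ext j; simp

lemma NtN (n : ℕ) : (Nm n)ᵀ * Nm n + vecMulVec (el n) (el n) = 1 := by
  ext i j
  simp only [Matrix.add_apply, Matrix.mul_apply, Matrix.transpose_apply, Nm, Matrix.of_apply,
    vecMulVec_apply, el, ite_mul, one_mul, zero_mul]
  have := fin_sum_succ (n := n) (i : ℕ) (fun k => if (j : ℕ) + 1 = k then (1 : ℝ) else 0)
  rw [this, Matrix.one_apply]
  have hi := i.2
  have hj := j.2
  simp only [Fin.ext_iff]
  split_ifs <;> first | omega | simp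

lemma EA (a : ℝ) (n : ℕ) : Em a n * (1 - a • Nm n) = 1 := by
  ext i j
  rw [mul_sub, mul_one, Matrix.mul_smul]
  simp only [Matrix.sub_apply, Matrix.smul_apply, Matrix.mul_apply, Nm, Em, Matrix.of_apply,
    mul_ite, mul_one, mul_zero, smul_eq_mul]
  have := fin_sum_succ (n := n) (j : ℕ) (fun k => if k ≤ (i : ℕ) then a ^ ((i : ℕ) - k) else 0)
  simp only [Fin.le_def]
  rw [this, Matrix.one_apply]
  have hi := i.2
  have hj := j.2
  simp only [Fin.ext_iff]
  rcases lt_trichotomy (i : ℕ) (j : ℕ) with h | h | h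
  · have h1 : ¬ (j : ℕ) ≤ i := by omega
    have h2 : ¬ (j : ℕ) + 1 ≤ i := by omega
    have h3 : ¬ (i : ℕ) = j := by omega
    simp [h1, h2, h3]
  · have h2 : ¬ (j : ℕ) + 1 ≤ i := by omega
    simp [h]
  · have h1 : (j : ℕ) ≤ i := by omega
    have h2 : (j : ℕ) + 1 ≤ i := by omega
    have h3 : ¬ (i : ℕ) = j := by omega
    have h4 : (j : ℕ) + 1 < n := by omega
    rw [if_pos h1, if_pos h4, if_pos h2, if_neg h3]
    have : (i : ℕ) - j = (i - (j + 1)) + 1 := by omega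
    rw [this, pow_succ]; ring

def sv (n : ℕ) (k : Fin n) : Fin n → ℝ :=
  fun j => Real.sin (((j : ℕ) + 1 : ℝ) * (((k : ℕ) + 1 : ℝ) * π / (n + 1)))

lemma T_eig (n : ℕ) (k : Fin n) :
    (Nm n + (Nm n)ᵀ) *ᵥ sv n k = (2 * Real.cos (((k : ℕ) + 1 : ℝ) * π / (n + 1))) • sv n k := by
  ext i
  rw [Matrix.add_mulVec]
  simp only [Pi.add_apply, Pi.smul_apply, smul_eq_mul, Matrix.mulVec, dotProduct, Nm,
    Matrix.of_apply, Matrix.transpose_apply, ite_mul, one_mul, zero_mul, sv]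
  set w := ((k : ℕ) + 1 : ℝ) * π / (n + 1) with hw
  have h1 := fin_sum_pred (n := n) (i : ℕ) i.2 (fun j => Real.sin ((j + 1 : ℝ) * w))
  have h2 := fin_sum_succ (n := n) (i : ℕ) (fun j => Real.sin ((j + 1 : ℝ) * w))
  rw [h1, h2]
  have e1 : (if 0 < (i : ℕ) then Real.sin ((((i : ℕ) - 1 : ℕ) + 1 : ℝ) * w) else 0)
      = Real.sin ((i : ℕ) * w) := by
    split_ifs with h
    · congr 2
      rw [Nat.cast_sub (by omega)]; simp
    · have : (i : ℕ) = 0 := by omega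
      simp [this]
  have e2 : (if (i : ℕ) + 1 < n then Real.sin ((((i : ℕ) + 1 : ℕ) + 1 : ℝ) * w) else 0)
      = Real.sin (((i : ℕ) + 2 : ℝ) * w) := by
    split_ifs with h
    · congr 2; push_cast; ring
    · have : (i : ℕ) + 1 = n := by have := i.2; omega
      have h3 : ((i : ℕ) : ℝ) + 2 = n + 1 := by
        have : ((i : ℕ) : ℝ) + 1 = n := by exact_mod_cast this
        linarith
      rw [h3, hw]
      have : ((n : ℝ) + 1) * (((k : ℕ) + 1 : ℝ) * π / (n + 1)) = ((k : ℕ) + 1 : ℕ) * π := by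
        have : (n : ℝ) + 1 ≠ 0 := by positivity
        push_cast; field_simp
      rw [this, Real.sin_nat_mul_pi]
  rw [e1, e2]
  have h4 : ((i : ℕ) : ℝ) * w = ((i : ℕ) + 1 : ℝ) * w - w := by ring
  have h5 : ((i : ℕ) + 2 : ℝ) * w = ((i : ℕ) + 1 : ℝ) * w + w := by ring
  rw [h4, h5, Real.sin_sub, Real.sin_add]; ring

lemma sv_pos (n : ℕ) (k : Fin n) : 0 < sv n k ⬝ᵥ sv n k := by
  have h0 : 0 < n := by have := k.2; omega
  have : 0 < sv n k ⟨0, h0⟩ := by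
    simp only [sv]
    have hk : ((k : ℕ) : ℝ) + 1 < n + 1 := by
      have := k.2
      exact_mod_cast Nat.succ_lt_succ this
    apply Real.sin_pos_of_pos_of_lt_pi
    · positivity
    · simp only [Nat.cast_zero, zero_add, one_mul]
      rw [div_lt_iff₀ (by positivity)]
      nlinarith [Real.pi_pos]
  rw [dotProduct]
  refine Finset.sum_pos' (fun i _ => mul_self_nonneg _) ⟨⟨0, h0⟩, Finset.mem_univ _, ?_⟩
  positivity

lemma sv_orth (n : ℕ) (k l : Fin n) (hkl : k ≠ l) : sv n k ⬝ᵥ sv n l = 0 := by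
  set T := Nm n + (Nm n)ᵀ with hT
  have hTs : Tᵀ = T := by rw [hT, Matrix.transpose_add, Matrix.transpose_transpose, add_comm]
  have h1 : (T *ᵥ sv n k) ⬝ᵥ sv n l = sv n k ⬝ᵥ (T *ᵥ sv n l) := by
    rw [Matrix.dotProduct_mulVec, ← Matrix.mulVec_transpose, hTs]
  rw [T_eig, T_eig, smul_dotProduct, dotProduct_smul, smul_eq_mul, smul_eq_mul] at h1
  have hin : ∀ m : Fin n, ((m : ℕ) + 1 : ℝ) * π / (n + 1) ∈ Set.Icc 0 π := by
    intro m
    have hk : ((m : ℕ) : ℝ) + 1 ≤ n + 1 := by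
      have := m.2
      exact_mod_cast (Nat.succ_lt_succ this).le
    refine ⟨by positivity, ?_⟩
    rw [div_le_iff₀ (by positivity)]
    nlinarith [Real.pi_pos]
  have hne : Real.cos (((k : ℕ) + 1 : ℝ) * π / (n + 1))
      ≠ Real.cos (((l : ℕ) + 1 : ℝ) * π / (n + 1)) := by
    intro h
    have h2 := Real.injOn_cos (hin k) (hin l) h
    have hn : (n : ℝ) + 1 ≠ 0 := by positivity
    have hp := Real.pi_ne_zero
    field_simp at h2
    have h3 : ((k : ℕ) : ℝ) = (l : ℕ) := by linarith
    exact hkl (Fin.ext (by exact_mod_cast h3))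
  have h4 : (Real.cos (((k : ℕ) + 1 : ℝ) * π / (n + 1))
      - Real.cos (((l : ℕ) + 1 : ℝ) * π / (n + 1))) * (sv n k ⬝ᵥ sv n l) = 0 := by linarith
  exact (mul_eq_zero.1 h4).resolve_left (sub_ne_zero.2 hne)

def Pm (n : ℕ) : Matrix (Fin n) (Fin n) ℝ :=
  Matrix.of fun j k => (√(sv n k ⬝ᵥ sv n k))⁻¹ * sv n k j

lemma PtP (n : ℕ) : (Pm n)ᵀ * Pm n = 1 := by
  ext k l
  have e : ((Pm n)ᵀ * Pm n) k l
      = (√(sv n k ⬝ᵥ sv n k))⁻¹ * (√(sv n l ⬝ᵥ sv n l))⁻¹ * (sv n k ⬝ᵥ sv n l) := by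
    simp only [Matrix.mul_apply, Matrix.transpose_apply, Pm, Matrix.of_apply, dotProduct]
    rw [Finset.mul_sum]
    exact Finset.sum_congr rfl fun i _ => by ring
  rw [e, Matrix.one_apply]
  split_ifs with h
  · subst h
    have := sv_pos n k
    rw [← mul_inv, Real.mul_self_sqrt this.le, inv_mul_cancel₀ this.ne']
  · rw [sv_orth n k l h, mul_zero]

lemma PPt (n : ℕ) : Pm n * (Pm n)ᵀ = 1 := mul_eq_one_comm.1 (PtP n)

def ang (n : ℕ) (k : Fin n) : ℝ := ((k : ℕ) + 1 : ℝ) * π / (n + 1)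

def bet (a : ℝ) (n : ℕ) (k : Fin n) : ℝ := 1 + a ^ 2 - 2 * a * Real.cos (ang n k)

lemma BP (a : ℝ) (n : ℕ) :
    ((1 + a ^ 2) • (1 : Matrix (Fin n) (Fin n) ℝ) - a • (Nm n + (Nm n)ᵀ)) * Pm n
      = Pm n * Matrix.diagonal (bet a n) := by
  ext j k
  rw [Matrix.mul_diagonal, sub_mul, Matrix.smul_mul, Matrix.smul_mul, one_mul]
  simp only [Matrix.sub_apply, Matrix.smul_apply, smul_eq_mul]
  have h := congrFun (T_eig n k) j
  have e : ((Nm n + (Nm n)ᵀ) * Pm n) j k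
      = (√(sv n k ⬝ᵥ sv n k))⁻¹ * ((Nm n + (Nm n)ᵀ) *ᵥ sv n k) j := by
    have e1 : ((Nm n + (Nm n)ᵀ) *ᵥ sv n k) j = ∑ i, (Nm n + (Nm n)ᵀ) j i * sv n k i := rfl
    have e2 : ∀ i, Pm n i k = (√(sv n k ⬝ᵥ sv n k))⁻¹ * sv n k i := fun i => rfl
    rw [Matrix.mul_apply, e1, Finset.mul_sum]
    refine Finset.sum_congr rfl fun i _ => ?_
    rw [e2]; ring
  rw [e, h]
  simp only [Pm, Matrix.of_apply, bet, ang, Pi.smul_apply, smul_eq_mul]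
  ring

lemma sherman {n : ℕ} (G K Y : Matrix (Fin n) (Fin n) ℝ) (e : Fin n → ℝ) (α : ℝ)
    (hKG : K * G = 1) (hKs : Kᵀ = K) (hY : (G + α • vecMulVec e e) * Y = 1)
    (hη : 1 + α * (e ⬝ᵥ K *ᵥ e) ≠ 0) (t : Fin n → ℝ) :
    t ⬝ᵥ K *ᵥ t = t ⬝ᵥ Y *ᵥ t + α / (1 + α * (e ⬝ᵥ K *ᵥ e)) * (t ⬝ᵥ K *ᵥ e) ^ 2 := by
  set y := Y *ᵥ t with hy
  have h1 : G *ᵥ y + (α * (e ⬝ᵥ y)) • e = t := by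
    have : (G + α • vecMulVec e e) *ᵥ y = t := by rw [hy, Matrix.mulVec_mulVec, hY, one_mulVec]
    rw [Matrix.add_mulVec, Matrix.smul_mulVec, Matrix.vecMulVec_mulVec] at this
    rw [← this]
    congr 1
    ext i; simp; ring
  have h2 : y + (α * (e ⬝ᵥ y)) • (K *ᵥ e) = K *ᵥ t := by
    conv_rhs => rw [← h1]
    rw [Matrix.mulVec_add, Matrix.mulVec_mulVec, hKG, one_mulVec, Matrix.mulVec_smul]
  have h3 : e ⬝ᵥ K *ᵥ t = t ⬝ᵥ K *ᵥ e := by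
    rw [Matrix.dotProduct_mulVec, ← Matrix.mulVec_transpose, hKs, dotProduct_comm]
  have h4 : e ⬝ᵥ y + α * (e ⬝ᵥ y) * (e ⬝ᵥ K *ᵥ e) = t ⬝ᵥ K *ᵥ e := by
    rw [← h3, ← h2, dotProduct_add, dotProduct_smul, smul_eq_mul]
  have h5 : t ⬝ᵥ y + α * (e ⬝ᵥ y) * (t ⬝ᵥ K *ᵥ e) = t ⬝ᵥ K *ᵥ t := by
    rw [← h2, dotProduct_add, dotProduct_smul, smul_eq_mul]
  rw [← h5]
  have h6 : e ⬝ᵥ y = (t ⬝ᵥ K *ᵥ e) / (1 + α * (e ⬝ᵥ K *ᵥ e)) := by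
    rw [eq_div_iff hη, ← h4]; ring
  rw [h6]; ring

lemma bet_pos (a : ℝ) (ha0 : 0 ≤ a) (ha1 : a < 1) (x : ℝ) : 0 < 1 + a ^ 2 - 2 * a * Real.cos x := by
  have := Real.cos_le_one x
  nlinarith [sq_nonneg (1 - a), mul_nonneg ha0 (sub_nonneg.2 this), mul_pos (sub_pos.2 ha1) (sub_pos.2 ha1)]

lemma source_decomp (a σ : ℝ) (ha0 : 0 ≤ a) (ha1 : a < 1) (n : ℕ) :
    ∃ r : Fin n → ℝ, ∀ t : Fin n → ℝ,
      σ ^ 2 * ∑ k, ((Em a n)ᵀ *ᵥ t) k ^ 2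
        = ∑ k, GM.S a σ (ang n k) * ((Pm n)ᵀ *ᵥ t) k ^ 2 + (∑ k, r k * t k) ^ 2 := by
  set E := Em a n with hE
  set A : Matrix (Fin n) (Fin n) ℝ := 1 - a • Nm n with hA
  have hEA : E * A = 1 := EA a n
  have hAE : A * E = 1 := mul_eq_one_comm.1 hEA
  set K := E * Eᵀ with hK
  have hKs : Kᵀ = K := by rw [hK, Matrix.transpose_mul, Matrix.transpose_transpose]
  have hKG : K * (Aᵀ * A) = 1 := by
    have : Eᵀ * Aᵀ = 1 := by rw [← Matrix.transpose_mul, hAE, Matrix.transpose_one]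
    rw [hK, Matrix.mul_assoc, ← Matrix.mul_assoc Eᵀ, this, one_mul, hEA]
  have hB : Aᵀ * A + a ^ 2 • vecMulVec (el n) (el n)
      = (1 + a ^ 2) • (1 : Matrix (Fin n) (Fin n) ℝ) - a • (Nm n + (Nm n)ᵀ) := by
    have := NtN n
    have h2 : vecMulVec (el n) (el n) = 1 - (Nm n)ᵀ * Nm n := by rw [← this]; abel
    rw [h2, hA, Matrix.transpose_sub, Matrix.transpose_one, Matrix.transpose_smul, sub_mul, mul_sub,
      mul_sub, one_mul, mul_one, one_mul, Matrix.smul_mul, Matrix.mul_smul, smul_smul, smul_sub,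
      add_smul, one_smul, smul_add, pow_two]
    abel
  set Y := Pm n * Matrix.diagonal (fun k => (bet a n k)⁻¹) * (Pm n)ᵀ with hYdef
  have hY : (Aᵀ * A + a ^ 2 • vecMulVec (el n) (el n)) * Y = 1 := by
    rw [hB, hYdef, ← Matrix.mul_assoc, ← Matrix.mul_assoc, BP, Matrix.mul_assoc (Pm n),
      Matrix.diagonal_mul_diagonal]
    have : (fun i => bet a n i * (bet a n i)⁻¹) = fun _ => 1 := by
      ext i; exact mul_inv_cancel₀ (bet_pos a ha0 ha1 _).ne'
    rw [this, Matrix.diagonal_one, mul_one, PPt]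
  have hquad : ∀ t : Fin n → ℝ, t ⬝ᵥ K *ᵥ t = ∑ k, (Eᵀ *ᵥ t) k ^ 2 := by
    intro t
    rw [hK, ← Matrix.mulVec_mulVec, Matrix.dotProduct_mulVec, ← Matrix.mulVec_transpose, dotProduct]
    exact Finset.sum_congr rfl fun i _ => by ring
  have hη : 0 < 1 + a ^ 2 * (el n ⬝ᵥ K *ᵥ el n) := by
    rw [hquad]; positivity
  have hYq : ∀ t : Fin n → ℝ, t ⬝ᵥ Y *ᵥ t = ∑ k, (bet a n k)⁻¹ * ((Pm n)ᵀ *ᵥ t) k ^ 2 := by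
    intro t
    rw [hYdef, ← Matrix.mulVec_mulVec, ← Matrix.mulVec_mulVec, Matrix.dotProduct_mulVec,
      ← Matrix.mulVec_transpose, dotProduct]
    refine Finset.sum_congr rfl fun i _ => ?_
    rw [Matrix.mulVec_diagonal]; ring
  set c := a ^ 2 / (1 + a ^ 2 * (el n ⬝ᵥ K *ᵥ el n)) with hc
  have hc0 : 0 ≤ c := by positivity
  refine ⟨(σ * √c) • (K *ᵥ el n), fun t => ?_⟩
  have := sherman (Aᵀ * A) K Y (el n) (a ^ 2) hKG hKs hY hη.ne' t
  rw [hquad, hYq] at this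
  rw [this, mul_add, Finset.mul_sum]
  congr 1
  · refine Finset.sum_congr rfl fun i _ => ?_
    simp only [GM.S, bet]; ring
  · have h1 : ∑ k, ((σ * √c) • (K *ᵥ el n)) k * t k = σ * √c * (t ⬝ᵥ K *ᵥ el n) := by
      rw [dotProduct, Finset.mul_sum]
      exact Finset.sum_congr rfl fun i _ => by simp; ring
    rw [h1, mul_pow, mul_pow, Real.sq_sqrt hc0]; ring

lemma pi_char {n : ℕ} (v : ℝ≥0) (c : Fin n → ℝ) :
    ∫ z : Fin n → ℝ, Complex.exp (((∑ i, c i * z i : ℝ) : ℂ) * Complex.I)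
        ∂(Measure.pi fun _ => gaussianReal 0 v)
      = Complex.exp (((-(v * ∑ i, c i ^ 2) / 2 : ℝ) : ℂ)) := by
  have h1 : ∀ z : Fin n → ℝ, Complex.exp (((∑ i, c i * z i : ℝ) : ℂ) * Complex.I)
      = ∏ i, Complex.exp ((c i : ℂ) * (z i : ℂ) * Complex.I) := by
    intro z
    rw [← Complex.exp_sum]
    congr 1
    push_cast
    rw [Finset.sum_mul]
  simp_rw [h1]
  rw [integral_fintype_prod_eq_prod (f := fun i (x : ℝ) => Complex.exp ((c i : ℂ) * (x : ℂ) * Complex.I))]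
  have h2 : ∀ i, ∫ x : ℝ, Complex.exp ((c i : ℂ) * (x : ℂ) * Complex.I) ∂(gaussianReal 0 v)
      = Complex.exp (-((v : ℝ) * (c i : ℂ) ^ 2) / 2) := by
    intro i
    rw [← charFun_apply_real, charFun_gaussianReal]
    congr 1
    push_cast
    ring
  simp_rw [h2]
  rw [← Complex.exp_sum]
  congr 1
  push_cast
  rw [Finset.mul_sum, neg_div, Finset.sum_div, ← Finset.sum_neg_distrib]
  exact Finset.sum_congr rfl fun i _ => by ring

lemma dual_eq {n : ℕ} (L : StrongDual ℝ (Fin n → ℝ)) :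
    ∃ t : Fin n → ℝ, ∀ u, L u = t ⬝ᵥ u := by
  refine ⟨fun i => L (Pi.single i 1), fun u => ?_⟩
  conv_lhs => rw [pi_eq_sum_univ' u]
  rw [map_sum, dotProduct]
  refine Finset.sum_congr rfl fun i _ => ?_
  rw [map_smul, smul_eq_mul, mul_comm]

def mixmap (a σ : ℝ) (n : ℕ) (r : Fin n → ℝ) (p : (Fin n → ℝ) × ℝ) : Fin n → ℝ :=
  Pm n *ᵥ (fun k => √(GM.S a σ (ang n k)) * p.1 k) + p.2 • r

lemma mixmap_meas (a σ : ℝ) (n : ℕ) (r : Fin n → ℝ) : Measurable (mixmap a σ n r) := by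
  apply Continuous.measurable
  unfold mixmap
  have : Continuous fun p : (Fin n → ℝ) × ℝ => (fun k => √(GM.S a σ (ang n k)) * p.1 k) := by fun_prop
  exact (Continuous.matrix_mulVec continuous_const this).add (by fun_prop)

lemma S_pos (a σ : ℝ) (ha0 : 0 ≤ a) (ha1 : a < 1) (hσ : 0 < σ) (x : ℝ) : 0 < GM.S a σ x :=
  div_pos (by positivity) (bet_pos a ha0 ha1 x)

lemma gaussPi_eq (σ : ℝ) (n : ℕ) :
    GM.gaussPi σ n = Measure.pi fun _ => gaussianReal 0 (Real.toNNReal (σ ^ 2)) := by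
  have : Real.toNNReal (σ ^ 2) = (⟨σ ^ 2, sq_nonneg σ⟩ : {r : ℝ // 0 ≤ r}) :=
    Real.toNNReal_of_nonneg (sq_nonneg σ)
  rw [this]; rfl

lemma law_eq (a σ : ℝ) (ha0 : 0 ≤ a) (ha1 : a < 1) (hσ : 0 < σ) (n : ℕ) :
    ∃ r : Fin n → ℝ, GM.sourceLaw a σ n = ((stdn n).prod gam).map (mixmap a σ n r) := by
  obtain ⟨r, hr⟩ := source_decomp a σ ha0 ha1 n
  refine ⟨r, ?_⟩
  have hev : Measurable (GM.evolve a n) := by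
    apply Continuous.measurable
    unfold GM.evolve
    fun_prop
  have hm := mixmap_meas a σ n r
  have : IsProbabilityMeasure (GM.gaussPi σ n) := by rw [gaussPi_eq]; infer_instance
  have : IsProbabilityMeasure (GM.sourceLaw a σ n) :=
    Measure.isProbabilityMeasure_map hev.aemeasurable
  have : IsProbabilityMeasure (((stdn n).prod gam).map (mixmap a σ n r)) :=
    Measure.isProbabilityMeasure_map hm.aemeasurable
  refine Measure.ext_of_charFunDual ?_
  ext L
  obtain ⟨t, ht⟩ := dual_eq L
  rw [charFunDual_apply, charFunDual_apply, GM.sourceLaw, integral_map hev.aemeasurable (by fun_prop),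
    integral_map hm.aemeasurable (by fun_prop)]
  have e1 : ∀ z, L (GM.evolve a n z) = ∑ i, ((Em a n)ᵀ *ᵥ t) i * z i := by
    intro z
    rw [ht, evolve_eq, Matrix.dotProduct_mulVec, ← Matrix.mulVec_transpose]; rfl
  have e2 : ∀ p : (Fin n → ℝ) × ℝ, L (mixmap a σ n r p)
      = ∑ i, (((Pm n)ᵀ *ᵥ t) i * √(GM.S a σ (ang n i))) * p.1 i + (∑ k, r k * t k) * p.2 := by
    intro p
    rw [ht, mixmap, dotProduct_add, Matrix.dotProduct_mulVec, ← Matrix.mulVec_transpose,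
      dotProduct_smul]
    congr 1
    · rw [dotProduct]
      exact Finset.sum_congr rfl fun i _ => by ring
    · rw [smul_eq_mul, mul_comm, dotProduct_comm]; rfl
  simp_rw [e1, e2]
  rw [gaussPi_eq, pi_char]
  have e3 : ∀ p : (Fin n → ℝ) × ℝ, Complex.exp (((∑ i, (((Pm n)ᵀ *ᵥ t) i * √(GM.S a σ (ang n i))) * p.1 i
        + (∑ k, r k * t k) * p.2 : ℝ) : ℂ) * Complex.I)
      = Complex.exp (((∑ i, (((Pm n)ᵀ *ᵥ t) i * √(GM.S a σ (ang n i))) * p.1 i : ℝ) : ℂ) * Complex.I)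
        * Complex.exp (((∑ k, r k * t k : ℝ) : ℂ) * (p.2 : ℂ) * Complex.I) := by
    intro p
    rw [← Complex.exp_add]
    congr 1
    rw [Complex.ofReal_add, add_mul, Complex.ofReal_mul]
  simp_rw [e3]
  rw [integral_prod_mul (fun w : Fin n → ℝ => Complex.exp (((∑ i, (((Pm n)ᵀ *ᵥ t) i * √(GM.S a σ (ang n i))) * w i : ℝ) : ℂ) * Complex.I))
    (fun x : ℝ => Complex.exp (((∑ k, r k * t k : ℝ) : ℂ) * (x : ℂ) * Complex.I))]
  rw [pi_char, ← charFun_apply_real, charFun_gaussianReal, ← Complex.exp_add]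
  congr 1
  have h := hr t
  have e4 : ∑ i, (((Pm n)ᵀ *ᵥ t) i * √(GM.S a σ (ang n i))) ^ 2
      = ∑ k, GM.S a σ (ang n k) * ((Pm n)ᵀ *ᵥ t) k ^ 2 := by
    refine Finset.sum_congr rfl fun i _ => ?_
    rw [mul_pow, Real.sq_sqrt (S_pos a σ ha0 ha1 hσ _).le, mul_comm]
  rw [e4]
  rw [Real.coe_toNNReal _ (sq_nonneg σ), h]
  push_cast
  ring

lemma meas_union {n M : ℕ} (g : Fin M → Fin n → ℝ) (D : ℝ) :
    MeasurableSet {u : Fin n → ℝ | ∃ m, ∑ i, (u i - g m i) ^ 2 ≤ D} := by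
  have : {u : Fin n → ℝ | ∃ m, ∑ i, (u i - g m i) ^ 2 ≤ D}
      = ⋃ m, {u : Fin n → ℝ | ∑ i, (u i - g m i) ^ 2 ≤ D} := by ext; simp
  rw [this]
  refine MeasurableSet.iUnion fun m => (isClosed_le ?_ continuous_const).measurableSet
  fun_prop

lemma orth_norm {n : ℕ} (x y : Fin n → ℝ) :
    ∑ i, ((Pm n *ᵥ x) i - y i) ^ 2 = ∑ i, (x i - ((Pm n)ᵀ *ᵥ y) i) ^ 2 := by
  have h : ∀ z : Fin n → ℝ, ∑ i, (Pm n *ᵥ z) i ^ 2 = ∑ i, z i ^ 2 := by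
    intro z
    have e : ∀ v : Fin n → ℝ, ∑ i, v i ^ 2 = v ⬝ᵥ v := by
      intro v; rw [dotProduct]; exact Finset.sum_congr rfl fun i _ => by ring
    rw [e, e, Matrix.dotProduct_mulVec, ← Matrix.mulVec_transpose, Matrix.mulVec_mulVec, PtP,
      one_mulVec]
  have h1 := h (x - (Pm n)ᵀ *ᵥ y)
  rw [Matrix.mulVec_sub, Matrix.mulVec_mulVec, PPt, one_mulVec] at h1
  simpa using h1

lemma source_bound (a σ : ℝ) (ha0 : 0 ≤ a) (ha1 : a < 1) (hσ : 0 < σ) (n M : ℕ)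
    (g : Fin M → Fin n → ℝ) (D B : ℝ)
    (hB : ∀ v : Fin M → Fin n → ℝ, (stdn n).real
      {w | ∃ m, ∑ i, (√(GM.S a σ (ang n i)) * w i - v m i) ^ 2 ≤ D} ≤ B) :
    (GM.sourceLaw a σ n).real {u | ∃ m, ∑ i, (u i - g m i) ^ 2 ≤ D} ≤ B := by
  obtain ⟨r, hr⟩ := law_eq a σ ha0 ha1 hσ n
  have hm := mixmap_meas a σ n r
  have hB0 : 0 ≤ B := le_trans measureReal_nonneg (hB 0)
  have hS := meas_union g D
  rw [measureReal_def, hr, Measure.map_apply hm hS, Measure.prod_apply_symm (hm hS)]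
  refine ENNReal.toReal_le_of_le_ofReal hB0 ?_
  calc _ ≤ ∫⁻ _ : ℝ, ENNReal.ofReal B ∂gam := by
        refine lintegral_mono fun y => ?_
        have := hB (fun m => (Pm n)ᵀ *ᵥ (g m - y • r))
        rw [measureReal_def, ← ENNReal.le_ofReal_iff_toReal_le (measure_ne_top _ _) hB0] at this
        refine le_trans (le_of_eq ?_) this
        congr 1
        ext w
        simp only [Set.mem_preimage, Set.mem_ofPred_eq]
        refine exists_congr fun m => ?_
        rw [← orth_norm]
        simp only [mixmap, Pi.add_apply, Pi.sub_apply]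
        have : ∀ i, (Pm n *ᵥ fun k => √(GM.S a σ (ang n k)) * w k) i + (y • r) i - g m i
          = (Pm n *ᵥ fun k => √(GM.S a σ (ang n k)) * w k) i - (g m i - (y • r) i) := fun i => by ring
        simp_rw [this]
    _ = ENNReal.ofReal B := by simp

lemma code_exists (a σ : ℝ) (n : ℕ) (d ε : ℝ) (hd : 0 < d) (hε : 0 < ε) :
    ∃ M, GM.IsCode a σ n M d ε := by
  have hev : Measurable (GM.evolve a n) := by
    apply Continuous.measurable
    unfold GM.evolve
    fun_prop
  have hp : IsProbabilityMeasure (GM.gaussPi σ n) := by rw [gaussPi_eq]; infer_instance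
  have hp' : IsProbabilityMeasure (GM.sourceLaw a σ n) :=
    Measure.isProbabilityMeasure_map hev.aemeasurable
  set e : ℕ → (Fin n → ℝ) := TopologicalSpace.denseSeq (Fin n → ℝ) with he
  have hdist : Continuous fun p : (Fin n → ℝ) × (Fin n → ℝ) => GM.distortion n p.1 p.2 := by
    unfold GM.distortion; fun_prop
  have hlim : ∀ u : Fin n → ℝ, Tendsto (fun N => GM.distortion n u (SimpleFunc.nearestPt e N u))
      atTop (nhds 0) := by
    intro u
    have h1 : Tendsto (fun N => SimpleFunc.nearestPt e N u) atTop (nhds u) :=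
      SimpleFunc.tendsto_nearestPt (TopologicalSpace.denseRange_denseSeq _ u)
    have h2 := (hdist.tendsto (u, u)).comp ((tendsto_const_nhds (x := u)).prodMk_nhds h1)
    have h3 : GM.distortion n u u = 0 := by simp [GM.distortion]
    simp only [h3] at h2
    exact h2
  have hm : ∀ N, AEStronglyMeasurable (fun u => GM.distortion n u (SimpleFunc.nearestPt e N u))
      (GM.sourceLaw a σ n) := by
    intro N
    exact (hdist.measurable.comp (measurable_id.prodMk (SimpleFunc.measurable _))).aestronglyMeasurable
  have ht := tendstoInMeasure_of_tendsto_ae hm (g := fun _ => 0) (ae_of_all _ hlim)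
  have h4 := ht (ENNReal.ofReal d) (by simpa using hd)
  obtain ⟨N, hN⟩ := (h4.eventually (Iic_mem_nhds (ENNReal.ofReal_pos.2 hε))).exists
  refine ⟨N + 1, fun u => ⟨SimpleFunc.nearestPtInd e N u, by
    have := SimpleFunc.nearestPtInd_le e N u; omega⟩, fun m => e m, ?_, ?_⟩
  · exact measurable_to_countable' (fun m => by
      have : (fun u => (⟨SimpleFunc.nearestPtInd e N u, by
        have := SimpleFunc.nearestPtInd_le e N u; omega⟩ : Fin (N + 1))) ⁻¹' {m} = (SimpleFunc.nearestPtInd e N) ⁻¹' {(m : ℕ)} := by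
        ext u; simp [Fin.ext_iff]
      rw [this]
      exact SimpleFunc.measurableSet_fiber _ _)
  · refine le_trans (measure_mono ?_) hN
    intro u hu
    simp only [Set.mem_ofPred_eq] at hu ⊢
    rw [edist_dist]
    apply ENNReal.ofReal_le_ofReal
    rw [Real.dist_eq, sub_zero]
    exact le_trans hu.le (le_abs_self _)

lemma code_converse (a σ : ℝ) (ha0 : 0 ≤ a) (ha1 : a < 1) (hσ : 0 < σ) (n : ℕ) (hn : 0 < n)
    (d ε : ℝ) (hd : 0 < d) (hε : 0 < ε) (B : ℝ)
    (hB : ∀ v : Fin (GM.Mstar a σ n d ε) → Fin n → ℝ, (stdn n).real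
      {w | ∃ m, ∑ i, (√(GM.S a σ (ang n i)) * w i - v m i) ^ 2 ≤ n * d} ≤ B) :
    1 - ε ≤ B ∧ 1 ≤ GM.Mstar a σ n d ε := by
  obtain ⟨f, g, hf, hfg⟩ : GM.IsCode a σ n (GM.Mstar a σ n d ε) d ε :=
    Nat.sInf_mem (s := {M | GM.IsCode a σ n M d ε}) (code_exists a σ n d ε hd hε)
  have hev : Measurable (GM.evolve a n) := by
    apply Continuous.measurable
    unfold GM.evolve
    fun_prop
  have hp : IsProbabilityMeasure (GM.gaussPi σ n) := by rw [gaussPi_eq]; infer_instance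
  have hp' : IsProbabilityMeasure (GM.sourceLaw a σ n) :=
    Measure.isProbabilityMeasure_map hev.aemeasurable
  constructor
  · have h1 := source_bound a σ ha0 ha1 hσ n _ g (n * d) B hB
    refine le_trans ?_ h1
    set T := {u : Fin n → ℝ | ∃ m, ∑ i, (u i - g m i) ^ 2 ≤ n * d} with hT
    have h2 : (GM.sourceLaw a σ n).real Tᶜ ≤ ε := by
      rw [measureReal_def]
      refine ENNReal.toReal_le_of_le_ofReal hε.le (le_trans (measure_mono ?_) hfg)
      intro u hu
      simp only [hT, Set.mem_compl_iff, Set.mem_ofPred_eq, not_exists, not_le] at hu ⊢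
      have := hu (f u)
      have hn' : (0 : ℝ) < n := by exact_mod_cast hn
      rw [GM.distortion, one_div, ← div_eq_inv_mul, lt_div_iff₀ hn', mul_comm]
      exact this
    rw [probReal_compl_eq_one_sub (meas_union g _)] at h2
    linarith
  · have := (f 0).pos
    omega

lemma riem (G : ℝ → ℝ) (hc : Continuous G) (hev : ∀ x, G (-x) = G x)
    (hanti : AntitoneOn G (Set.Icc 0 π)) (hpos : ∀ x, 0 ≤ G x) (n : ℕ) :
    |∑ k : Fin n, G (ang n k) - n * ((1 / (2 * π)) * ∫ w in Set.Icc (-π) π, G w)| ≤ G 0 := by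
  have hpi := Real.pi_pos
  have hn : (0 : ℝ) < n + 1 := by positivity
  set J := ∫ x in (0 : ℝ)..π, G x with hJ
  have h1 : ∫ w in Set.Icc (-π) π, G w = 2 * J := by
    rw [integral_Icc_eq_integral_Ioc, ← intervalIntegral.integral_of_le (by linarith),
      ← intervalIntegral.integral_add_adjacent_intervals (b := 0) (hc.intervalIntegrable _ _)
        (hc.intervalIntegrable _ _)]
    have : ∫ x in (-π)..0, G x = J := by
      have h := intervalIntegral.integral_comp_neg (a := 0) (b := π) G
      simp only [hev, neg_zero] at h
      rw [hJ, h]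
    rw [this]; ring
  set f : ℝ → ℝ := fun x => G (π / (n + 1) * x) with hf
  have hfa : AntitoneOn f (Set.Icc (0 : ℝ) (0 + ((n + 1 : ℕ) : ℝ))) := by
    intro x hx y hy hxy
    have hmem : ∀ z ∈ Set.Icc (0 : ℝ) (0 + ((n + 1 : ℕ) : ℝ)), π / (n + 1) * z ∈ Set.Icc 0 π := by
      intro z hz
      have h2 : z ≤ n + 1 := by have := hz.2; push_cast at this; linarith
      refine ⟨mul_nonneg (by positivity) hz.1, ?_⟩
      rw [div_mul_eq_mul_div, div_le_iff₀ hn]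
      exact mul_le_mul_of_nonneg_left h2 hpi.le
    exact hanti (hmem x hx) (hmem y hy) (mul_le_mul_of_nonneg_left hxy (by positivity))
  have hI : ∫ x in (0 : ℝ)..(0 + ((n + 1 : ℕ) : ℝ)), f x = (n + 1) * (J / π) := by
    rw [hf, intervalIntegral.integral_comp_mul_left _ (by positivity), smul_eq_mul]
    have : π / (n + 1) * (0 + ((n + 1 : ℕ) : ℝ)) = π := by push_cast; field_simp; ring
    rw [this, mul_zero, ← hJ]; field_simp
  have hlo := hfa.integral_le_sum
  have hup := hfa.sum_le_integral
  rw [hI] at hlo hup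
  have hX : ∑ k : Fin n, G (ang n k) = ∑ i ∈ Finset.range n, f ((i : ℝ) + 1) := by
    rw [← Fin.sum_univ_eq_sum_range (fun i => f ((i : ℝ) + 1)) n]
    refine Finset.sum_congr rfl fun k _ => ?_
    simp only [hf, ang]; congr 1; field_simp
  have hlo2 : ∑ i ∈ Finset.range (n + 1), f (0 + (i : ℝ)) = ∑ k : Fin n, G (ang n k) + G 0 := by
    rw [Finset.sum_range_succ', hX]
    simp [hf]
  have hup2 : ∑ i ∈ Finset.range (n + 1), f (0 + ((i + 1 : ℕ) : ℝ))
      = ∑ k : Fin n, G (ang n k) + f (n + 1) := by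
    rw [Finset.sum_range_succ, hX]
    simp
  have hmax : ∑ i ∈ Finset.range (n + 1), f (0 + (i : ℝ)) ≤ (n + 1) * G 0 := by
    have : ∀ i ∈ Finset.range (n + 1), f (0 + (i : ℝ)) ≤ G 0 := by
      intro i hi
      have h0 : f 0 = G 0 := by simp [hf]
      rw [← h0]
      have hi' : (i : ℝ) ≤ n + 1 := by
        have := (Finset.mem_range.1 hi).le
        exact_mod_cast this
      refine hfa ⟨le_refl _, by positivity⟩ ⟨by positivity, by push_cast; linarith⟩ (by positivity)
    have h := Finset.sum_le_card_nsmul _ _ _ this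
    rw [Finset.card_range, nsmul_eq_mul] at h
    push_cast at h; exact h
  have hJ0 : 0 ≤ J / π := div_nonneg (intervalIntegral.integral_nonneg hpi.le fun x _ => hpos x) hpi.le
  have hJ1 : J / π ≤ G 0 := by
    have := hlo.trans hmax
    exact le_of_mul_le_mul_left this hn
  have hfn : 0 ≤ f (n + 1) := hpos _
  rw [hup2] at hup
  rw [hlo2] at hlo
  have e : (1 / (2 * π)) * (2 * J) = J / π := by field_simp
  rw [h1, e, abs_le]
  constructor <;> nlinarith

lemma S_cont (a σ : ℝ) (ha0 : 0 ≤ a) (ha1 : a < 1) : Continuous (GM.S a σ) := by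
  unfold GM.S
  refine Continuous.div continuous_const (by fun_prop) fun x => (bet_pos a ha0 ha1 x).ne'

lemma S_even (a σ x : ℝ) : GM.S a σ (-x) = GM.S a σ x := by simp [GM.S]

lemma S_anti (a σ : ℝ) (ha0 : 0 ≤ a) (ha1 : a < 1) : AntitoneOn (GM.S a σ) (Set.Icc 0 π) := by
  intro x hx y hy hxy
  unfold GM.S
  have h := Real.strictAntiOn_cos.antitoneOn hx hy hxy
  have := mul_le_mul_of_nonneg_left h (by positivity : 0 ≤ 2 * a)
  refine div_le_div_of_nonneg_left (by positivity) (bet_pos a ha0 ha1 x) (by linarith)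

lemma ll_eq (θ s : ℝ) (hθ : 0 < θ) (hs : 0 < s) : ll θ s = max 0 (1 / 2 * Real.log (s / θ)) := by
  unfold ll
  rcases le_total s θ with h | h
  · rw [max_eq_left h, div_self hθ.ne', Real.log_one, mul_zero, max_eq_left]
    have := Real.log_nonpos (by positivity) ((div_le_one hθ).2 h)
    linarith
  · rw [max_eq_right h, max_eq_right]
    have := Real.log_nonneg ((one_le_div hθ).2 h)
    linarith

lemma cc_sq (θ s : ℝ) (hθ : 0 < θ) (hs : 0 < s) : 4 * cc θ s ^ 2 = min 1 ((s / θ) ^ 2) := by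
  unfold cc
  rcases le_total s θ with h | h
  · have h1 : s / θ ≤ 1 := (div_le_one hθ).2 h
    rw [min_eq_right h, min_eq_right (pow_le_one₀ (by positivity) h1)]
    field_simp; norm_num
  · have h1 : 1 ≤ s / θ := (one_le_div hθ).2 h
    rw [min_eq_left h, min_eq_left (one_le_pow₀ h1)]
    field_simp; norm_num

lemma riem_all (a σ θ d : ℝ) (ha0 : 0 ≤ a) (ha1 : a < 1) (hσ : 0 < σ) (hθ : 0 < θ)
    (hw : GM.waterEq a σ θ d) :
    ∃ K : ℝ, 0 < K ∧ ∀ n : ℕ,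
      |∑ k : Fin n, cc θ (GM.S a σ (ang n k)) - n * d / (2 * θ)| ≤ K ∧
      |∑ k : Fin n, ll θ (GM.S a σ (ang n k)) - n * GM.RU a σ θ| ≤ K ∧
      |2 * ∑ k : Fin n, cc θ (GM.S a σ (ang n k)) ^ 2 - n * GM.VU a σ θ| ≤ K := by
  have hS := S_pos a σ ha0 ha1 hσ
  have hc := S_cont a σ ha0 ha1
  have han := S_anti a σ ha0 ha1
  have h1 := riem (fun x => min θ (GM.S a σ x)) (by fun_prop) (fun x => by simp only [S_even])
    (fun x hx y hy hxy => min_le_min le_rfl (han hx hy hxy)) (fun x => (lt_min hθ (hS x)).le)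
  have h2 := riem (fun x => max 0 (1 / 2 * Real.log (GM.S a σ x / θ)))
    (by
      have : Continuous fun x => Real.log (GM.S a σ x / θ) :=
        Continuous.log (by fun_prop) fun x => (div_pos (hS x) hθ).ne'
      fun_prop) (fun x => by simp only [S_even])
    (fun x hx y hy hxy => by
      refine max_le_max le_rfl (mul_le_mul_of_nonneg_left ?_ (by norm_num))
      exact Real.log_le_log (div_pos (hS y) hθ) (div_le_div_of_nonneg_right (han hx hy hxy) hθ.le))
    (fun x => le_max_left _ _)
  have h3 := riem (fun x => min 1 ((GM.S a σ x / θ) ^ 2)) (by fun_prop) (fun x => by simp only [S_even])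
    (fun x hx y hy hxy => by
      refine min_le_min le_rfl (pow_le_pow_left₀ (div_pos (hS y) hθ).le ?_ 2)
      exact div_le_div_of_nonneg_right (han hx hy hxy) hθ.le)
    (fun x => by positivity)
  set K1 := min θ (GM.S a σ 0)
  set K2 := max 0 (1 / 2 * Real.log (GM.S a σ 0 / θ))
  set K3 := min 1 ((GM.S a σ 0 / θ) ^ 2)
  have hK1 : 0 < K1 := lt_min hθ (hS 0)
  have hK2 : 0 ≤ K2 := le_max_left _ _
  have hK3 : 0 ≤ K3 := by positivity
  have hK1' : 0 < K1 / (2 * θ) := by positivity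
  refine ⟨K1 / (2 * θ) + K2 + K3, by positivity, fun n => ⟨?_, ?_, ?_⟩⟩
  · have h := h1 n
    rw [← hw] at h
    have e : ∑ k : Fin n, cc θ (GM.S a σ (ang n k)) - n * d / (2 * θ)
        = (∑ k : Fin n, min θ (GM.S a σ (ang n k)) - n * d) / (2 * θ) := by
      rw [sub_div, Finset.sum_div]; rfl
    rw [e, abs_div, abs_of_pos (by positivity : 0 < 2 * θ)]
    have := div_le_div_of_nonneg_right h (by positivity : 0 ≤ 2 * θ)
    linarith
  · have h := h2 n
    have e : ∑ k : Fin n, ll θ (GM.S a σ (ang n k))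
        = ∑ k : Fin n, max 0 (1 / 2 * Real.log (GM.S a σ (ang n k) / θ)) :=
      Finset.sum_congr rfl fun k _ => ll_eq θ _ hθ (hS _)
    rw [e]
    refine h.trans ?_
    linarith
  · have h := h3 n
    have e : 2 * ∑ k : Fin n, cc θ (GM.S a σ (ang n k)) ^ 2
        = 1 / 2 * ∑ k : Fin n, min 1 ((GM.S a σ (ang n k) / θ) ^ 2) := by
      rw [← Finset.sum_congr rfl fun (k : Fin n) _ => cc_sq θ _ hθ (hS (ang n k)), ← Finset.mul_sum]; ring
    have e2 : GM.VU a σ θ = 1 / 2 * ((1 / (2 * π)) * ∫ w in Set.Icc (-π) π, min 1 ((GM.S a σ w / θ) ^ 2)) := by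
      unfold GM.VU
      have := Real.pi_pos
      field_simp; ring
    rw [e, e2]
    rw [show ∀ x y z : ℝ, 1 / 2 * x - y * (1 / 2 * z) = 1 / 2 * (x - y * z) from fun x y z => by ring,
      abs_mul, abs_of_pos (by norm_num : (0 : ℝ) < 1 / 2)]
    have := abs_nonneg (∑ k : Fin n, min 1 ((GM.S a σ (ang n k) / θ) ^ 2) - n * ((1 / (2 * π)) * ∫ w in Set.Icc (-π) π, min 1 ((GM.S a σ w / θ) ^ 2)))
    linarith

lemma VU_pos (a σ θ : ℝ) (ha0 : 0 ≤ a) (ha1 : a < 1) (hσ : 0 < σ) (hθ : 0 < θ) :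
    0 < GM.VU a σ θ := by
  have hS := S_pos a σ ha0 ha1 hσ
  have hc := S_cont a σ ha0 ha1
  have hpi := Real.pi_pos
  unfold GM.VU
  refine mul_pos (by positivity) ?_
  rw [integral_Icc_eq_integral_Ioc, ← intervalIntegral.integral_of_le (by linarith)]
  refine intervalIntegral.intervalIntegral_pos_of_pos ?_ (fun x => ?_) (by linarith)
  · exact Continuous.intervalIntegrable (by fun_prop) _ _
  · have := div_pos (hS x) hθ
    positivity

lemma one_n (a σ θ d ε K : ℝ) (ha0 : 0 ≤ a) (ha1 : a < 1) (hσ : 0 < σ) (hθ : 0 < θ)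
    (hd : 0 < d) (hε : 0 < ε) (n : ℕ) (hn : 0 < n)
    (hK : |∑ k : Fin n, cc θ (GM.S a σ (ang n k)) - n * d / (2 * θ)| ≤ K)
    (W Λ : ℝ) (hW : W = 2 * ∑ k : Fin n, cc θ (GM.S a σ (ang n k)) ^ 2) (hW0 : 0 < W)
    (hΛ : Λ = ∑ k : Fin n, ll θ (GM.S a σ (ang n k))) :
    GM.gaussQ ((Real.log (GM.Mstar a σ n d ε) + 1 / 2 * Real.log n - Λ) / √W)
      ≤ ε + 5 * (1 / (2 * √W)) + Real.exp K / √n := by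
  have hS := S_pos a σ ha0 ha1 hσ
  have hn' : (0 : ℝ) < n := by exact_mod_cast hn
  have hM1 : 1 ≤ GM.Mstar a σ n d ε :=
    (code_converse a σ ha0 ha1 hσ n hn d ε hd hε 1 (fun v => measureReal_le_one)).2
  have hM : (0 : ℝ) < GM.Mstar a σ n d ε := by exact_mod_cast hM1
  set M := GM.Mstar a σ n d ε with hMdef
  set L := Real.log M + 1 / 2 * Real.log n with hL
  set c : Fin n → ℝ := fun k => cc θ (GM.S a σ (ang n k)) with hc
  have hsW : 0 < √W := Real.sqrt_pos.2 hW0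
  have h1 := (code_converse a σ ha0 ha1 hσ n hn d ε hd hε _
    (fun v => converse_coord θ (n * d) L (fun i => GM.S a σ (ang n i)) v hθ (fun i => hS _))).1
  have hset : {w : Fin n → ℝ | L ≤ Wb (fun i => cc θ (GM.S a σ (ang n i))) w
        + ∑ i, ll θ (GM.S a σ (ang n i))}
      = {x | (L - Λ) / √W ≤ Wb (fun i => c i / √W) x} := by
    ext w
    simp only [Set.mem_ofPred_eq]
    have : Wb (fun i => c i / √W) w = Wb c w / √W := by
      unfold Wb
      rw [Finset.sum_div]
      exact Finset.sum_congr rfl fun i _ => by ring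
    rw [this, div_le_div_iff_of_pos_right hsW, ← hΛ, sub_le_iff_le_add]
  have hmeas : MeasurableSet {w : Fin n → ℝ | L ≤ Wb (fun i => cc θ (GM.S a σ (ang n i))) w
        + ∑ i, ll θ (GM.S a σ (ang n i))} :=
    (isClosed_le continuous_const ((Wb_cont _).add continuous_const)).measurableSet
  rw [probReal_compl_eq_one_sub hmeas, hset] at h1
  have h2 := berry_tail (fun i => c i / √W) (1 / (2 * √W)) (by positivity)
    (fun i => by
      rw [abs_div, abs_of_pos hsW, one_div, mul_inv, ← div_eq_mul_inv, div_le_div_iff_of_pos_right hsW]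
      have h3 : 0 ≤ c i := by
        simp only [hc, cc]; exact div_nonneg (lt_min hθ (hS _)).le (by positivity)
      rw [abs_of_nonneg h3]
      simp only [hc, cc]
      rw [div_le_iff₀ (by positivity)]
      have := min_le_left θ (GM.S a σ (ang n i))
      linarith)
    (by
      simp only [div_pow, Real.sq_sqrt hW0.le]
      rw [← Finset.sum_div, ← mul_div_assoc, ← hW, div_self hW0.ne'])
    ((L - Λ) / √W)
  have h3 : (M : ℝ) * Real.exp (n * d / (2 * θ) - ∑ i, cc θ (GM.S a σ (ang n i)) - L)
      ≤ Real.exp K / √n := by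
    have e1 : Real.exp L = M * √n := by
      rw [hL, Real.exp_add, Real.exp_log hM, Real.sqrt_eq_rpow, Real.rpow_def_of_pos hn', mul_comm (1 / 2 : ℝ)]
    rw [Real.exp_sub, e1]
    have hsn : 0 < √(n : ℝ) := Real.sqrt_pos.2 hn'
    have e2 : ∀ x : ℝ, (M : ℝ) * (x / (M * √n)) = x / √n := fun x => by field_simp
    rw [e2]
    refine div_le_div_of_nonneg_right (Real.exp_le_exp.2 ?_) hsn.le
    have := (abs_le.1 hK).1
    linarith
  linarith

lemma assemble (a σ ε d θ Qinv : ℝ)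
    (ha0 : 0 ≤ a) (ha1 : a < 1) (hσ : 0 < σ)
    (hε : 0 < ε) (hd0 : 0 < d)
    (hθ : 0 < θ) (hwater : GM.waterEq a σ θ d)
    (hQinv : GM.gaussQ Qinv = ε) :
    ∃ C : ℝ, 0 < C ∧ ∀ᶠ n : ℕ in Filter.atTop,
      GM.RU a σ θ + Real.sqrt (GM.VU a σ θ / n) * Qinv - Real.log n / (2 * n) - C / n
        ≤ GM.rate a σ n d ε := by
  obtain ⟨K, hK, hR⟩ := riem_all a σ θ d ha0 ha1 hσ hθ hwater
  have hV := VU_pos a σ θ ha0 ha1 hσ hθ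
  set V := GM.VU a σ θ with hVdef
  obtain ⟨κ, hκ, hQ⟩ := gaussQ_lower Qinv
  set C3 := 5 / (2 * √(V / 2)) + Real.exp K with hC3
  have hsV2 : 0 < √(V / 2) := Real.sqrt_pos.2 (by positivity)
  have hC3p : 0 < C3 := by positivity
  set D := 2 * C3 / κ with hD
  have hDp : 0 < D := by positivity
  refine ⟨K + |Qinv| * (K / √V) + √(V + K) * D, by positivity, ?_⟩
  obtain ⟨N1, hN1⟩ := exists_nat_ge (2 * K / V)
  obtain ⟨N2, hN2⟩ := exists_nat_ge (D ^ 2)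
  filter_upwards [eventually_ge_atTop (max 1 (max N1 N2))] with n hn
  have hn1 : 1 ≤ n := (le_max_left _ _).trans hn
  have hnN1 : N1 ≤ n := (le_max_left _ _).trans ((le_max_right _ _).trans hn)
  have hnN2 : N2 ≤ n := (le_max_right _ _).trans ((le_max_right _ _).trans hn)
  have hn1' : (1 : ℝ) ≤ n := by exact_mod_cast hn1
  have hn0 : (0 : ℝ) < n := by linarith
  have hnK : 2 * K / V ≤ n := hN1.trans (by exact_mod_cast hnN1)
  have hnD : D ^ 2 ≤ n := hN2.trans (by exact_mod_cast hnN2)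
  obtain ⟨r1, r2, r3⟩ := hR n
  set W := 2 * ∑ k : Fin n, cc θ (GM.S a σ (ang n k)) ^ 2 with hW
  set Λ := ∑ k : Fin n, ll θ (GM.S a σ (ang n k)) with hΛ
  have hWlo : n * (V / 2) ≤ W := by
    rw [div_le_iff₀ hV] at hnK
    have := (abs_le.1 r3).1
    linarith
  have hW0 : 0 < W := lt_of_lt_of_le (by positivity) hWlo
  have hWhi : W ≤ n * (V + K) := by
    have := (abs_le.1 r3).2
    nlinarith
  have hone := one_n a σ θ d ε K ha0 ha1 hσ hθ hd0 hε n hn1 r1 W Λ hW hW0 hΛ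
  set M := GM.Mstar a σ n d ε with hM
  set t := (Real.log M + 1 / 2 * Real.log n - Λ) / √W with ht
  have hsn : 0 < √(n : ℝ) := Real.sqrt_pos.2 hn0
  have hsW : 0 < √W := Real.sqrt_pos.2 hW0
  have hsWlo : √n * √(V / 2) ≤ √W := by
    rw [← Real.sqrt_mul hn0.le]; exact Real.sqrt_le_sqrt hWlo
  have hsWhi : √W ≤ √n * √(V + K) := by
    rw [← Real.sqrt_mul hn0.le]; exact Real.sqrt_le_sqrt hWhi
  have hQt : GM.gaussQ t ≤ ε + C3 / √n := by
    have h1 : 5 * (1 / (2 * √W)) ≤ 5 / (2 * √(V / 2)) / √n := by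
      rw [mul_one_div, div_div]
      refine div_le_div_of_nonneg_left (by norm_num) (by positivity) ?_
      nlinarith
    have h2 : C3 / √n = 5 / (2 * √(V / 2)) / √n + Real.exp K / √n := by rw [hC3, add_div]
    linarith
  have hδ1 : D / √n ≤ 1 := by
    rw [div_le_one hsn]
    exact Real.le_sqrt_of_sq_le hnD
  have htlo : Qinv - D / √n ≤ t := by
    by_contra hlt
    push Not at hlt
    have h1 := gaussQ_anti _ _ hlt.le
    have h2 := hQ (D / √n) (by positivity) hδ1
    rw [hQinv] at h2
    have h3 : κ * (D / √n) = 2 * (C3 / √n) := by rw [hD]; field_simp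
    have h4 : 0 < C3 / √n := by positivity
    linarith
  have hmain : Λ + √W * (Qinv - D / √n) ≤ Real.log M + 1 / 2 * Real.log n := by
    rw [ht, le_div_iff₀ hsW] at htlo
    linarith
  have hWD : √W * (D / √n) ≤ √(V + K) * D := by
    calc √W * (D / √n) ≤ √n * √(V + K) * (D / √n) :=
          mul_le_mul_of_nonneg_right hsWhi (by positivity)
      _ = √(V + K) * D := by field_simp
  have hsV : 0 < √V := Real.sqrt_pos.2 hV
  have hdiff : |√W - √(n * V)| ≤ K / √V := by
    have hnV : √V ≤ √(n * V) := Real.sqrt_le_sqrt (by nlinarith)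
    have e : (√W - √(n * V)) * (√W + √(n * V)) = W - n * V := by
      have e1 := Real.mul_self_sqrt hW0.le
      have e2 := Real.mul_self_sqrt (by positivity : 0 ≤ n * V)
      linear_combination e1 - e2
    rw [le_div_iff₀ hsV]
    calc |√W - √(n * V)| * √V ≤ |√W - √(n * V)| * (√W + √(n * V)) :=
          mul_le_mul_of_nonneg_left (by linarith) (abs_nonneg _)
      _ = |W - n * V| := by
          rw [← e, abs_mul, abs_of_pos (by linarith : 0 < √W + √(n * V))]
      _ ≤ K := r3
  have hQd : √(n * V) * Qinv - |Qinv| * (K / √V) ≤ √W * Qinv := by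
    have h1 : |(√W - √(n * V)) * Qinv| ≤ K / √V * |Qinv| := by
      rw [abs_mul]; exact mul_le_mul_of_nonneg_right hdiff (abs_nonneg _)
    have := (abs_le.1 h1).1
    linarith
  have hr2 := (abs_le.1 r2).1
  rw [GM.rate, le_div_iff₀ hn0]
  have hsq : √(V / n) * n = √(n * V) := by
    rw [Real.sqrt_div hV.le, Real.sqrt_mul hn0.le]
    have := Real.mul_self_sqrt hn0.le
    field_simp
    linarith [sq (√(n : ℝ))]
  have e : (GM.RU a σ θ + √(V / n) * Qinv - Real.log n / (2 * n)
      - (K + |Qinv| * (K / √V) + √(V + K) * D) / n) * n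
      = n * GM.RU a σ θ + √(n * V) * Qinv - 1 / 2 * Real.log n
        - (K + |Qinv| * (K / √V) + √(V + K) * D) := by
    rw [← hsq]; field_simp
  rw [e]
  linarith

theorem stmt10 (a σ ε d θ Qinv : ℝ)
    (ha0 : 0 ≤ a) (ha1 : a < 1) (hσ : 0 < σ)
    (hε : ε ∈ Set.Ioo (0 : ℝ) 1)
    (hd0 : 0 < d) (hdmax : d < σ ^ 2 / (1 - a ^ 2))
    (hθ : 0 < θ) (hwater : GM.waterEq a σ θ d)
    (hQinv : GM.gaussQ Qinv = ε) :
    ∃ C : ℝ, 0 < C ∧ ∀ᶠ n : ℕ in Filter.atTop,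
      GM.RU a σ θ + Real.sqrt (GM.VU a σ θ / n) * Qinv - Real.log n / (2 * n) - C / n
        ≤ GM.rate a σ n d ε := by
  exact assemble a σ ε d θ Qinv ha0 ha1 hσ hε.1 hd0 hθ hwater hQinv

end
end
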